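/- There exists a constant C > 0 such that for every f ∈ RBMO(μ) and every g ∈ L¹(μ), one has ‖fg‖_{L^℘(ν)} ≤ C ( ‖f‖_{RBMO(μ)} + |f_{𝕢̃}| ) ‖g‖_{L¹(μ)}, where 𝕢 is the unit cube centered at the origin and 𝕢̃ its smallest (ρ,β_ρ)-doubling dyadic dilate, and dν(x) = dμ(x)/log(e+|x|). -/

import Mathlib

open MeasureTheory Metric Set Filter
open scoped ENNReal NNReal BigOperators Topology

noncomputable section

/-- Euclidean space `ℝ^d`. -/
abbrev Euc (d : ℕ) := EuclideanSpace ℝ (Fin d)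

/-- A (closed, axis-parallel) cube in `ℝ^d`, given by its center and side length. -/
structure Cube (d : ℕ) where
  center : Euc d
  side : ℝ

namespace Cube

/-- The underlying set of a cube. -/
def set {d : ℕ} (Q : Cube d) : Set (Euc d) :=
  {y : Euc d | ∀ i, |y i - Q.center i| ≤ Q.side / 2}

/-- The concentric dilate `αQ` of a cube. -/
def dilate {d : ℕ} (Q : Cube d) (α : ℝ) : Cube d := ⟨Q.center, α * Q.side⟩

end Cube

/-- `Q` is a genuine cube for `μ`: positive side length, centered at a point of `supp μ`. -/
def IsCube {d : ℕ} (μ : Measure (Euc d)) (Q : Cube d) : Prop :=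
  0 < Q.side ∧ ∀ r : ℝ, 0 < r → 0 < μ (Metric.ball Q.center r)

/-- The mean value `f_Q = μ(Q)⁻¹ ∫_Q f dμ`. -/
def cubeAvg {d : ℕ} (μ : Measure (Euc d)) (Q : Cube d) (f : Euc d → ℝ) : ℝ :=
  (μ Q.set).toReal⁻¹ * ∫ x in Q.set, f x ∂μ

/-- `N_{Q,R}`: the smallest positive integer `k` with `2^k ℓ(Q) ≥ ℓ(R)`. -/
def NQR {d : ℕ} (Q R : Cube d) : ℕ :=
  sInf {k : ℕ | 0 < k ∧ R.side ≤ 2 ^ k * Q.side}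

/-- The Tolsa coefficient `S_{Q,R} = 1 + ∑_{k=1}^{N_{Q,R}} μ(2^k Q)/ℓ(2^k Q)^n`. -/
def SQR {d : ℕ} (μ : Measure (Euc d)) (n : ℕ) (Q R : Cube d) : ℝ :=
  1 + ∑ k ∈ Finset.Icc 1 (NQR Q R),
      (μ (Q.dilate (2 ^ k)).set).toReal / (2 ^ k * Q.side) ^ n

/-- `Q` is `(α,β)`-doubling: `μ(αQ) ≤ β μ(Q)`. -/
def IsDoubling {d : ℕ} (μ : Measure (Euc d)) (α β : ℝ) (Q : Cube d) : Prop :=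
  μ (Q.dilate α).set ≤ ENNReal.ofReal β * μ Q.set

/-- `Q̃ = 2^N Q`, `N` the smallest non-negative integer making `2^N Q` `(ρ,β)`-doubling. -/
def tilde {d : ℕ} (μ : Measure (Euc d)) (ρ β : ℝ) (Q : Cube d) : Cube d :=
  Q.dilate (2 ^ sInf {N : ℕ | IsDoubling μ ρ β (Q.dilate (2 ^ N))})

/-- `C` is an `RBMO(μ)` bound for `f` (with parameters `η, ρ, β`). -/
def RBMOBound {d : ℕ} (μ : Measure (Euc d)) (n : ℕ) (η ρ β : ℝ)
    (f : Euc d → ℝ) (C : ℝ) : Prop :=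
  (∀ Q : Cube d, IsCube μ Q →
      ∫ x in Q.set, |f x - cubeAvg μ (tilde μ ρ β Q) f| ∂μ
        ≤ C * (μ (Q.dilate η).set).toReal) ∧
  (∀ Q R : Cube d, IsCube μ Q → IsCube μ R → Q.set ⊆ R.set →
      IsDoubling μ ρ β Q → IsDoubling μ ρ β R →
      |cubeAvg μ Q f - cubeAvg μ R f| ≤ C * SQR μ n Q R)

/-- `f ∈ RBMO(μ)`. -/
def MemRBMO {d : ℕ} (μ : Measure (Euc d)) (n : ℕ) (η ρ β : ℝ) (f : Euc d → ℝ) : Prop :=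
  LocallyIntegrable f μ ∧ ∃ C : ℝ, 0 ≤ C ∧ RBMOBound μ n η ρ β f C

/-- The `RBMO(μ)` norm of `f`. -/
def rbmoNorm {d : ℕ} (μ : Measure (Euc d)) (n : ℕ) (η ρ β : ℝ) (f : Euc d → ℝ) : ℝ :=
  sInf {C : ℝ | 0 ≤ C ∧ RBMOBound μ n η ρ β f C}

/-- `C` is an `rbmo(μ)` (local `RBMO`) bound for `f`. -/
def RbmoLocBound {d : ℕ} (μ : Measure (Euc d)) (n : ℕ) (η ρ β : ℝ)
    (f : Euc d → ℝ) (C : ℝ) : Prop :=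
  (∀ Q : Cube d, IsCube μ Q → Q.side ≤ 1 →
      ∫ x in Q.set, |f x - cubeAvg μ (tilde μ ρ β Q) f| ∂μ
        ≤ C * (μ (Q.dilate η).set).toReal) ∧
  (∀ Q R : Cube d, IsCube μ Q → IsCube μ R → Q.side ≤ 1 → Q.set ⊆ R.set →
      IsDoubling μ ρ β Q → IsDoubling μ ρ β R →
      |cubeAvg μ Q f - cubeAvg μ R f| ≤ C * SQR μ n Q R) ∧
  (∀ Q : Cube d, IsCube μ Q → 1 < Q.side →
      ∫ x in Q.set, |f x| ∂μ ≤ C * (μ (Q.dilate η).set).toReal)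

/-- `f ∈ rbmo(μ)`. -/
def MemRbmoLoc {d : ℕ} (μ : Measure (Euc d)) (n : ℕ) (η ρ β : ℝ) (f : Euc d → ℝ) : Prop :=
  LocallyIntegrable f μ ∧ ∃ C : ℝ, 0 ≤ C ∧ RbmoLocBound μ n η ρ β f C

/-- The `rbmo(μ)` norm of `f`. -/
def rbmoLocNorm {d : ℕ} (μ : Measure (Euc d)) (n : ℕ) (η ρ β : ℝ) (f : Euc d → ℝ) : ℝ :=
  sInf {C : ℝ | 0 ≤ C ∧ RbmoLocBound μ n η ρ β f C}

/-- The data of an `∞`-block: `b = ∑ λ_j a_j`, supported in `R`, with `a_j` supported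
in `Q_j ⊂ R` and `‖a_j‖_{L^∞(μ)} ≤ (μ(2Q_j) S_{Q_j,R})⁻¹`, `∑_j |λ_j| < ∞`. -/
structure PreBlock {d : ℕ} (μ : Measure (Euc d)) (n : ℕ) : Type where
  R : Cube d
  Qs : ℕ → Cube d
  lam : ℕ → ℝ
  a : ℕ → Euc d → ℝ
  isCubeR : IsCube μ R
  isCubeQs : ∀ j, IsCube μ (Qs j)
  subsetQR : ∀ j, (Qs j).set ⊆ R.set
  measA : ∀ j, Measurable (a j)
  suppA : ∀ j, Function.support (a j) ⊆ (Qs j).set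
  boundA : ∀ j x, |a j x| ≤ ((μ ((Qs j).dilate 2).set).toReal * SQR μ n (Qs j) R)⁻¹
  summable : Summable fun j => |lam j|

/-- The function determined by a block. -/
def PreBlock.fn {d : ℕ} {μ : Measure (Euc d)} {n : ℕ} (b : PreBlock μ n) : Euc d → ℝ :=
  fun x => ∑' j, b.lam j * b.a j x

/-- `|b| = ∑_j |λ_j|`. -/
def PreBlock.size {d : ℕ} {μ : Measure (Euc d)} {n : ℕ} (b : PreBlock μ n) : ℝ :=
  ∑' j, |b.lam j|

/-- An `∞`-atomic block: an `∞`-block with vanishing integral. -/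
structure AtomicBlock {d : ℕ} (μ : Measure (Euc d)) (n : ℕ) extends PreBlock μ n where
  cancel : ∫ x, (∑' j, lam j * a j x) ∂μ = 0

/-- The function determined by an atomic block. -/
def AtomicBlock.fn {d : ℕ} {μ : Measure (Euc d)} {n : ℕ} (b : AtomicBlock μ n) : Euc d → ℝ :=
  b.toPreBlock.fn

/-- `|b|_{H¹} = ∑_j |λ_j|`. -/
def AtomicBlock.size {d : ℕ} {μ : Measure (Euc d)} {n : ℕ} (b : AtomicBlock μ n) : ℝ :=
  b.toPreBlock.size

/-- The class of test functions `F(x)` of Tolsa's grand maximal function. -/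
def TestFun {d : ℕ} (μ : Measure (Euc d)) (n : ℕ) (x : Euc d) (φ : Euc d → ℝ) : Prop :=
  Integrable φ μ ∧ ContDiff ℝ 1 φ ∧ (∫ y, |φ y| ∂μ) ≤ 1 ∧
  (∀ y, 0 ≤ φ y) ∧ (∀ y, y ≠ x → φ y ≤ (‖y - x‖ ^ n)⁻¹) ∧
  (∀ y, y ≠ x → ‖fderiv ℝ φ y‖ ≤ (‖y - x‖ ^ (n + 1))⁻¹)

/-- The grand maximal function `M f(x) = sup_{φ ∈ F(x)} |∫ f φ dμ|`. -/
def grandM {d : ℕ} (μ : Measure (Euc d)) (n : ℕ) (f : Euc d → ℝ) (x : Euc d) : ℝ :=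
  sSup {r : ℝ | ∃ φ : Euc d → ℝ, TestFun μ n x φ ∧ r = |∫ y, f y * φ y ∂μ|}

/-- The local class `F_loc(x)`: test functions supported in the cube `Q(x,1)`. -/
def TestFunLoc {d : ℕ} (μ : Measure (Euc d)) (n : ℕ) (x : Euc d) (φ : Euc d → ℝ) : Prop :=
  TestFun μ n x φ ∧ Function.support φ ⊆ (Cube.mk x 1).set

/-- The local grand maximal function `M^{(1)} f(x) = sup_{φ ∈ F_loc(x)} |∫ f φ dμ|`. -/
def grandMLoc {d : ℕ} (μ : Measure (Euc d)) (n : ℕ) (f : Euc d → ℝ) (x : Euc d) : ℝ :=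
  sSup {r : ℝ | ∃ φ : Euc d → ℝ, TestFunLoc μ n x φ ∧ r = |∫ y, f y * φ y ∂μ|}

/-- The Orlicz quasi-norm of `u` on the set `E`, for the Orlicz function `P`
(with value `∞` when no admissible constant exists). -/
def orliczNormOn {α : Type*} [MeasurableSpace α] (P : ℝ → ℝ) (lam : Measure α)
    (E : Set α) (u : α → ℝ) : ℝ≥0∞ :=
  sInf {k : ℝ≥0∞ | 0 < k ∧ k ≠ ∞ ∧
    ∫⁻ x in E, ENNReal.ofReal (P (|u x| / k.toReal)) ∂lam ≤ 1}

/-- The Orlicz quasi-norm of `u`. -/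
def orliczNorm {α : Type*} [MeasurableSpace α] (P : ℝ → ℝ) (lam : Measure α)
    (u : α → ℝ) : ℝ≥0∞ :=
  orliczNormOn P lam Set.univ u

/-- `℘(t) = t / log(e+t)`. -/
def wp (t : ℝ) : ℝ := t / Real.log (Real.exp 1 + t)

/-- `℘̃(t) = t · log(e+t)`. -/
def wpDual (t : ℝ) : ℝ := t * Real.log (Real.exp 1 + t)

/-- `Ξ(t) = e^t − 1`. -/
def XiFun (t : ℝ) : ℝ := Real.exp t - 1

/-- `dν(x) = dμ(x)/log(e+|x|)`. -/
def nuMeas {d : ℕ} (μ : Measure (Euc d)) : Measure (Euc d) :=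
  μ.withDensity fun x => ENNReal.ofReal (Real.log (Real.exp 1 + ‖x‖))⁻¹

/-- `dσ(x) = dμ(x)/(1+|x|)^{2n+κ}`. -/
def sigmaMeas {d : ℕ} (μ : Measure (Euc d)) (n : ℕ) (κ : ℝ) : Measure (Euc d) :=
  μ.withDensity fun x => ENNReal.ofReal (((1 + ‖x‖) ^ (2 * (n : ℝ) + κ))⁻¹)

/-- The unit cube `m + [0,1)^d` of the lattice `ℤ^d`. -/
def latCube (d : ℕ) (m : Fin d → ℤ) : Set (Euc d) :=
  {x : Euc d | ∀ i, (m i : ℝ) ≤ x i ∧ x i < (m i : ℝ) + 1}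

/-- A positive monotone function of growth `r ^ n` has, above every scale, a scale which is doubling
in several senses and below which it decays faster than `r ^ n`. -/
theorem exists_good_scale {n : ℕ} {C ρ β η : ℝ} (hC : 0 < C) (hρ : 1 < ρ) (hβ : ρ ^ n < β) :
    ∃ B K κ : ℝ, 0 < B ∧ 0 < K ∧ 0 < κ ∧ ∀ φ : ℝ → ℝ, Monotone φ → (∀ r, 0 < r → 0 < φ r) →
      (∀ r, 0 < r → φ r ≤ C * r ^ n) → ∀ a, 0 < a → ∃ b, a ≤ b ∧ φ (ρ * b) ≤ β * φ b ∧
        φ (η * b) ≤ B * φ (b / 2) ∧ ∀ u, a ≤ u → u ≤ b → φ u ≤ K * u ^ n * (u / b) ^ κ := by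
  have hρ0 : 0 < ρ := by linarith
  obtain ⟨p, hp⟩ := pow_unbounded_of_one_lt (max 2 η) hρ
  have hp2 : 2 ≤ ρ ^ p := (le_max_left _ _).trans hp.le
  have hpη : η ≤ ρ ^ p := (le_max_right _ _).trans hp.le
  have hρn : 0 < ρ ^ n := by positivity
  have hβ0 : 0 < β := hρn.trans hβ
  obtain ⟨m, hm⟩ := pow_unbounded_of_one_lt ((ρ ^ n) ^ (2 * p)) ((one_lt_div hρn).2 hβ)
  rw [div_pow, lt_div_iff₀ (by positivity)] at hm
  have hm0 : m ≠ 0 := by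
    rintro rfl
    have : 1 ≤ (ρ ^ n) ^ (2 * p) := one_le_pow₀ (one_le_pow₀ hρ.le)
    simp at hm
    linarith
  have hp0 : p ≠ 0 := by
    rintro rfl
    norm_num at hp2
  obtain ⟨q, hq⟩ : ∃ q : ℝ, q = ρ ^ (m + 2 * p) := ⟨_, rfl⟩
  have hq1 : 1 < q := hq ▸ one_lt_pow₀ hρ (by omega)
  have hqle : ∀ e ≤ m + 2 * p, ρ ^ e ≤ q := fun e he => hq ▸ pow_le_pow_right₀ hρ.le he
  have hq0 : 0 < q := by linarith
  have hqB : q ^ n < β ^ m := by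
    refine lt_of_eq_of_lt ?_ hm
    rw [hq, ← pow_mul, ← pow_mul, ← pow_mul, ← pow_add]
    ring_nf
  obtain ⟨B, hB⟩ : ∃ B : ℝ, B = β ^ m := ⟨_, rfl⟩
  rw [← hB] at hqB
  have hB0 : 0 < B := hB ▸ pow_pos hβ0 m
  obtain ⟨κ, hκ⟩ : ∃ κ : ℝ, κ = Real.logb q (B / q ^ n) := ⟨_, rfl⟩
  have hκ0 : 0 < κ := hκ ▸ Real.logb_pos hq1 ((one_lt_div (by positivity)).2 hqB)
  have hqκ : q ^ n * q ^ κ = B := by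
    rw [hκ, Real.rpow_logb hq0 hq1.ne' (by positivity)]
    field_simp
  refine ⟨B, C * (q ^ n * (q * q) ^ κ), κ, hB0, by positivity, hκ0, ?_⟩
  intro φ hmono hpos hgr a ha
  have hex : ∃ k : ℕ, φ (q ^ (k + 1) * a) ≤ B * φ (q ^ k * a) := by
    by_contra! hcon
    have h1 : ∀ k : ℕ, B ^ k * φ a ≤ φ (q ^ k * a) := by
      intro k
      induction k with
      | zero => simp
      | succ k ih =>
        calc B ^ (k + 1) * φ a = B * (B ^ k * φ a) := by ring
          _ ≤ B * φ (q ^ k * a) := by gcongr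
          _ ≤ _ := (hcon k).le
    obtain ⟨k, hk⟩ := pow_unbounded_of_one_lt (C * a ^ n / φ a)
      ((one_lt_div (by positivity : 0 < q ^ n)).2 hqB)
    rw [div_lt_iff₀ (hpos a ha), div_pow, div_mul_eq_mul_div, lt_div_iff₀ (by positivity)] at hk
    have h2 := (h1 k).trans (hgr _ (by positivity))
    have h3 : C * (q ^ k * a) ^ n = C * a ^ n * (q ^ n) ^ k := by
      rw [mul_pow, ← pow_mul, ← pow_mul, mul_comm k n]; ring
    linarith
  classical
  obtain ⟨k, hk, hkmin⟩ : ∃ k : ℕ, φ (q ^ (k + 1) * a) ≤ B * φ (q ^ k * a) ∧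
      ∀ j < k, B * φ (q ^ j * a) ≤ φ (q ^ (j + 1) * a) :=
    ⟨Nat.find hex, Nat.find_spec hex, fun j hj => (not_le.1 (Nat.find_min hex hj)).le⟩
  have hdec : ∀ i j : ℕ, j + i = k → B ^ i * φ (q ^ j * a) ≤ φ (q ^ k * a) := by
    intro i
    induction i with
    | zero => rintro j rfl; simp
    | succ i ih =>
      intro j hj
      calc B ^ (i + 1) * φ (q ^ j * a) = B ^ i * (B * φ (q ^ j * a)) := by ring
        _ ≤ B ^ i * φ (q ^ (j + 1) * a) := by gcongr; exact hkmin j (by omega)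
        _ ≤ _ := ih (j + 1) (by omega)
  obtain ⟨A, hA⟩ : ∃ A : ℝ, A = q ^ k * a := ⟨_, rfl⟩
  rw [← hA] at hk hdec
  have hA0 : 0 < A := by rw [hA]; positivity
  have haA : a ≤ A := hA ▸ le_mul_of_one_le_left ha.le (one_le_pow₀ hq1.le)
  have hkA : φ (q * A) ≤ B * φ A := by
    rw [hA, ← mul_assoc, ← pow_succ', ← hA]; exact hk
  obtain ⟨i, him, hi⟩ : ∃ i < m, φ (ρ ^ (p + i + 1) * A) ≤ β * φ (ρ ^ (p + i) * A) := by
    by_contra! hcon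
    have h1 : ∀ i ≤ m, β ^ i * φ (ρ ^ p * A) ≤ φ (ρ ^ (p + i) * A) := by
      intro i
      induction i with
      | zero => simp
      | succ i ih =>
        intro him
        calc β ^ (i + 1) * φ (ρ ^ p * A) = β * (β ^ i * φ (ρ ^ p * A)) := by ring
          _ ≤ β * φ (ρ ^ (p + i) * A) := by gcongr; exact ih (by omega)
          _ ≤ _ := (hcon i (by omega)).le
    obtain ⟨m', rfl⟩ := Nat.exists_eq_succ_of_ne_zero hm0
    have h2 := hcon m' (by omega)
    have h3 := h1 m' (by omega)
    have h4 : φ (ρ ^ (p + m' + 1) * A) ≤ φ (q * A) := by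
      apply hmono
      gcongr
      exact hqle _ (by omega)
    have h5 : φ A ≤ φ (ρ ^ p * A) := hmono (le_mul_of_one_le_left hA0.le (by linarith))
    have h6 : B * φ A ≤ B * φ (ρ ^ p * A) := by gcongr
    have h7 : B * φ (ρ ^ p * A) = β * (β ^ m' * φ (ρ ^ p * A)) := by rw [hB, pow_succ]; ring
    have h8 : β * (β ^ m' * φ (ρ ^ p * A)) ≤ β * φ (ρ ^ (p + m') * A) := by gcongr
    linarith
  obtain ⟨b, hb⟩ : ∃ b : ℝ, b = ρ ^ (p + i) * A := ⟨_, rfl⟩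
  rw [← hb] at hi
  have hAb : 2 * A ≤ b := by
    rw [hb, pow_add]
    have : 1 ≤ ρ ^ i := one_le_pow₀ hρ.le
    have : 2 ≤ ρ ^ p * ρ ^ i := by nlinarith
    gcongr
  have hb0 : 0 < b := by linarith
  have hbq : b ≤ q * A := by
    rw [hb]
    gcongr
    exact hqle _ (by omega)
  refine ⟨b, by linarith, ?_, ?_, ?_⟩
  · rw [hb, ← mul_assoc, ← pow_succ', ← hb]; exact hi
  · calc φ (η * b) ≤ φ (q * A) := by
          apply hmono
          calc η * b ≤ ρ ^ p * b := by gcongr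
            _ = ρ ^ (p + (p + i)) * A := by rw [hb, pow_add ρ p (p + i)]; ring
            _ ≤ q * A := by
              gcongr
              exact hqle _ (by omega)
      _ ≤ B * φ A := hkA
      _ ≤ B * φ (b / 2) := by gcongr; apply hmono; linarith
  · intro u hau hub
    have hu0 : 0 < u := by linarith
    obtain ⟨j, hj1, hj2⟩ := exists_nat_pow_near ((one_le_div ha).2 hau) hq1
    rw [le_div_iff₀ ha] at hj1
    rw [div_lt_iff₀ ha] at hj2
    have hqn : 1 ≤ q ^ n := one_le_pow₀ hq1.le
    by_cases hjk : j + 1 ≤ k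
    · obtain ⟨i', hi'⟩ := Nat.exists_eq_add_of_le hjk
      obtain ⟨v, hv⟩ : ∃ v : ℝ, v = q ^ (j + 1) * a := ⟨_, rfl⟩
      rw [← hv] at hj2
      have hv0 : 0 < v := by rw [hv]; positivity
      have h1 : B ^ i' * φ v ≤ C * A ^ n :=
        hv ▸ (hdec i' (j + 1) hi'.symm).trans (hgr A hA0)
      have hAv : A = q ^ i' * v := by rw [hA, hv, hi']; ring
      have hBi : B ^ i' = (q ^ i') ^ n * (q ^ i') ^ κ := by
        rw [← hqκ, mul_pow, pow_right_comm, ← Real.rpow_natCast (q ^ κ),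
          ← Real.rpow_mul hq0.le, mul_comm κ, Real.rpow_mul hq0.le, Real.rpow_natCast]
      rw [hAv, hBi, mul_pow] at h1
      have hD : 0 < (q ^ i') ^ n := by positivity
      have h2 : φ v * (q ^ i') ^ κ ≤ C * v ^ n := by
        refine le_of_mul_le_mul_left ?_ hD
        linarith
      have hvu : v ≤ q * u := by
        rw [hv, pow_succ']
        nlinarith
      have h3 : φ v ≤ C * v ^ n * (v / A) ^ κ := by
        have : v / A = (q ^ i')⁻¹ := by rw [hAv]; field_simp
        rw [this, Real.inv_rpow (by positivity), ← div_eq_mul_inv, le_div_iff₀ (by positivity)]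
        exact h2
      calc φ u ≤ φ v := hmono hj2.le
        _ ≤ C * v ^ n * (v / A) ^ κ := h3
        _ ≤ C * (q * u) ^ n * (q * u / (b / q)) ^ κ := by
          have : b / q ≤ A := by rw [div_le_iff₀ hq0]; linarith
          gcongr
        _ = C * (q ^ n * (q * q) ^ κ) * u ^ n * (u / b) ^ κ := by
          have : q * u / (b / q) = (q * q) * (u / b) := by field_simp
          rw [this, Real.mul_rpow (by positivity) (by positivity), mul_pow]; ring
    · have hAu : A ≤ u := by
        refine le_trans ?_ hj1
        rw [hA]
        gcongr
        · exact hq1.le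
        · omega
      have h1 : 1 ≤ q * (u / b) := by
        rw [mul_div_assoc', one_le_div hb0]
        nlinarith
      have h2 : 1 ≤ (q * q) ^ κ * (u / b) ^ κ := by
        rw [← Real.mul_rpow (by positivity) (by positivity)]
        apply Real.one_le_rpow _ hκ0.le
        have : 0 ≤ q * (u / b) := by positivity
        nlinarith
      calc φ u ≤ C * u ^ n := hgr u hu0
        _ ≤ C * u ^ n * (q ^ n * ((q * q) ^ κ * (u / b) ^ κ)) :=
          le_mul_of_one_le_right (by positivity) (one_le_mul_of_one_le_of_one_le hqn h2)
        _ = _ := by ring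

/-- Every closed ball centered at `x` has positive measure. -/
def BallsPos {E : Type*} [PseudoMetricSpace E] [MeasurableSpace E] (μ : Measure E) (x : E) : Prop :=
  ∀ r : ℝ, 0 < r → 0 < μ (closedBall x r)

/-- The mean value of `f` on `closedBall x r`. -/
def ballAvg {E : Type*} [PseudoMetricSpace E] [MeasurableSpace E] (μ : Measure E) (f : E → ℝ)
    (x : E) (r : ℝ) : ℝ :=
  (μ.real (closedBall x r))⁻¹ * ∫ y in closedBall x r, f y ∂μ

/-- The ball `closedBall x r` is `(ρ, β)`-doubling. -/
def BallDoubling {E : Type*} [PseudoMetricSpace E] [MeasurableSpace E] (μ : Measure E) (ρ β : ℝ)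
    (x : E) (r : ℝ) : Prop :=
  μ.real (closedBall x (ρ * r)) ≤ β * μ.real (closedBall x r)

/-- A doubling ball which moreover controls the measure of its `η`-dilate
by the measure of its half. -/
def BallGood {E : Type*} [PseudoMetricSpace E] [MeasurableSpace E] (μ : Measure E) (η ρ β B : ℝ)
    (x : E) (r : ℝ) : Prop :=
  BallDoubling μ ρ β x r ∧ μ.real (closedBall x (η * r)) ≤ B * μ.real (closedBall x (r / 2))

/-- The measure `μ` has growth `r ^ n` on balls centered on its support. -/
def BallGrowth {E : Type*} [PseudoMetricSpace E] [MeasurableSpace E] (μ : Measure E) (n : ℕ)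
    (C : ℝ) : Prop :=
  ∀ x, BallsPos μ x → ∀ r : ℝ, 0 < r → μ.real (closedBall x r) ≤ C * r ^ n

/-- Between the scales `a` and `b` the measure of balls centered at `x` is negligible
with respect to `r ^ n`. -/
def BallDecay {E : Type*} [PseudoMetricSpace E] [MeasurableSpace E] (μ : Measure E) (n : ℕ)
    (K κ : ℝ) (x : E) (a b : ℝ) : Prop :=
  ∀ u, a ≤ u → u ≤ b → μ.real (closedBall x u) ≤ K * u ^ n * (u / b) ^ κ

/-- `RBMO` with constant `1`, in terms of balls. -/
structure BallRBMO {E : Type*} [PseudoMetricSpace E] [MeasurableSpace E] (μ : Measure E) (n : ℕ)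
    (η ρ β : ℝ) (f : E → ℝ) : Prop where
  locallyIntegrable : LocallyIntegrable f μ
  oscillation : ∀ x, BallsPos μ x → ∀ r : ℝ, 0 < r → ∀ N : ℕ, BallDoubling μ ρ β x (2 ^ N * r) →
    (∀ i < N, ¬ BallDoubling μ ρ β x (2 ^ i * r)) →
    ∫ y in closedBall x r, |f y - ballAvg μ f x (2 ^ N * r)| ∂μ ≤ μ.real (closedBall x (η * r))
  compare : ∀ x z, BallsPos μ x → BallsPos μ z → ∀ r b : ℝ, 0 < r → 0 < b →
    closedBall z r ⊆ closedBall x b → BallDoubling μ ρ β z r → BallDoubling μ ρ β x b →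
    ∀ N : ℕ, 0 < N → b ≤ 2 ^ N * r → (∀ k, 0 < k → k < N → 2 ^ k * r < b) →
    |ballAvg μ f z r - ballAvg μ f x b| ≤
      1 + ∑ k ∈ Finset.Icc 1 N, μ.real (closedBall z (2 ^ k * r)) / (2 ^ k * (2 * r)) ^ n

theorem ae_ballsPos {E : Type*} [PseudoMetricSpace E] [HereditarilyLindelofSpace E]
    [MeasurableSpace E] {μ : Measure E} : ∀ᵐ x ∂μ, BallsPos μ x := by
  filter_upwards [Measure.support_mem_ae (μ := μ)] with x hx r hr
  exact (Measure.mem_support_iff_forall x).1 hx _ (closedBall_mem_nhds x hr)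

section Balls

variable {E : Type*} [NormedAddCommGroup E] [NormedSpace ℝ E] [FiniteDimensional ℝ E]
  [MeasurableSpace E] [BorelSpace E] {μ : Measure E} [IsLocallyFiniteMeasure μ]
  {n : ℕ} {C η ρ β B K κ : ℝ} {f : E → ℝ}

theorem real_closedBall_mono {x y : E} {r s : ℝ} (h : closedBall x r ⊆ closedBall y s) :
    μ.real (closedBall x r) ≤ μ.real (closedBall y s) :=
  measureReal_mono h measure_closedBall_lt_top.ne

theorem BallsPos.real_pos {x : E} (hx : BallsPos μ x) {r : ℝ} (hr : 0 < r) :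
    0 < μ.real (closedBall x r) :=
  ENNReal.toReal_pos (hx r hr).ne' measure_closedBall_lt_top.ne

theorem exists_ballGood (hC : 0 < C) (hρ : 1 < ρ) (hβ : ρ ^ n < β) (hgr : BallGrowth μ n C) :
    ∃ B K κ : ℝ, 0 < B ∧ 0 < K ∧ 0 < κ ∧ ∀ x, BallsPos μ x → ∀ a, 0 < a →
      ∃ b, a ≤ b ∧ BallGood μ η ρ β B x b ∧ BallDecay μ n K κ x a b := by
  obtain ⟨B, K, κ, hB, hK, hκ, h⟩ := exists_good_scale (n := n) (η := η) hC hρ hβ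
  refine ⟨B, K, κ, hB, hK, hκ, fun x hx a ha => ?_⟩
  obtain ⟨b, hab, h1, h2, h3⟩ := h (fun r => μ.real (closedBall x r))
    (fun r s hrs => real_closedBall_mono (closedBall_subset_closedBall hrs))
    (fun r hr => hx.real_pos hr) (hgr x hx) a ha
  exact ⟨b, hab, ⟨h1, h2⟩, h3⟩

/-- Mean values over a ball at the bottom and at the top of a range of decay are comparable. -/
theorem exists_compare_of_decay (hC : 0 < C) (hK : 0 < K) (hκ : 0 < κ) (hgr : BallGrowth μ n C) :
    ∃ D : ℝ, 0 < D ∧ ∀ f, BallRBMO μ n η ρ β f → ∀ x z, BallsPos μ x → BallsPos μ z →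
      ∀ a b r : ℝ, 0 < a → BallDecay μ n K κ x a b → a ≤ 4 * r → dist z x ≤ r → 0 < b →
      closedBall z r ⊆ closedBall x b → BallDoubling μ ρ β z r → BallDoubling μ ρ β x b →
      |ballAvg μ f z r - ballAvg μ f x b| ≤ D := by
  obtain ⟨t, ht⟩ : ∃ t : ℝ, t = 2 ^ (-κ) := ⟨_, rfl⟩
  have ht0 : 0 < t := ht ▸ Real.rpow_pos_of_pos two_pos _
  have ht1 : t < 1 := ht ▸ Real.rpow_lt_one_of_one_lt_of_neg one_lt_two (by linarith)
  obtain ⟨L, hL⟩ : ∃ L : ℝ, L = (K + C) * (t⁻¹ * t⁻¹) := ⟨_, rfl⟩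
  have hL0 : 0 < L := by rw [hL]; positivity
  have ht2 : 0 < 1 - t := by linarith
  refine ⟨1 + L * (1 - t)⁻¹, by positivity, ?_⟩
  intro f hf x z hx hz a b r ha hdec har hzx hb hsub hdz hdx
  have hr : 0 < r := by linarith
  have hex : ∃ N : ℕ, 0 < N ∧ b ≤ 2 ^ N * r := by
    obtain ⟨N, hN⟩ := pow_unbounded_of_one_lt (b / r) (one_lt_two (α := ℝ))
    rw [div_lt_iff₀ hr] at hN
    refine ⟨N + 1, by omega, ?_⟩
    rw [pow_succ]; linarith
  classical
  obtain ⟨N, ⟨hN0, hN⟩, hmin⟩ : ∃ N : ℕ, (0 < N ∧ b ≤ 2 ^ N * r) ∧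
      ∀ k, 0 < k → k < N → 2 ^ k * r < b :=
    ⟨Nat.find hex, Nat.find_spec hex, fun k hk hkN => by
      have := Nat.find_min hex hkN
      push Not at this
      exact this hk⟩
  refine (hf.compare x z hx hz r b hr hb hsub hdz hdx N hN0 hN hmin).trans ?_
  gcongr
  have hterm : ∀ k ∈ Finset.Icc 1 N,
      μ.real (closedBall z (2 ^ k * r)) / (2 ^ k * (2 * r)) ^ n ≤ L * t ^ (N - k) := by
    intro k hk
    rw [Finset.mem_Icc] at hk
    have hu0 : 0 < 2 ^ k * (2 * r) := by positivity
    rw [div_le_iff₀ (by positivity)]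
    by_cases hkN : k + 2 ≤ N
    · obtain ⟨i, rfl⟩ := Nat.exists_eq_add_of_le hkN
      have h1 := hmin (k + 1) (by omega) (by omega)
      have h2 := hmin (k + 1 + i) (by omega) (by omega)
      have hk1 : (2 : ℝ) ≤ 2 ^ k := le_self_pow₀ one_le_two (by omega)
      have h3 : μ.real (closedBall z (2 ^ k * r)) ≤ μ.real (closedBall x (2 ^ k * (2 * r))) := by
        apply real_closedBall_mono
        apply closedBall_subset_closedBall'
        nlinarith
      have h4 := hdec (2 ^ k * (2 * r)) (by nlinarith) (by rw [pow_succ] at h1; linarith)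
      have h5 : (2 ^ k * (2 * r) / b) ^ κ ≤ t ^ i := by
        have : 2 ^ k * (2 * r) / b ≤ (2 ^ i)⁻¹ := by
          rw [div_le_iff₀ hb, ← div_eq_inv_mul, le_div_iff₀ (by positivity)]
          refine le_trans (le_of_eq ?_) h2.le
          rw [pow_add, pow_succ]; ring
        calc (2 ^ k * (2 * r) / b) ^ κ ≤ ((2 ^ i)⁻¹ : ℝ) ^ κ := by gcongr
          _ = t ^ i := by
            rw [ht, ← Real.rpow_natCast, ← Real.rpow_natCast, ← Real.rpow_neg two_pos.le,
              ← Real.rpow_mul two_pos.le, ← Real.rpow_mul two_pos.le]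
            ring_nf
      have h6 : k + 2 + i - k = i + 2 := by omega
      calc μ.real (closedBall z (2 ^ k * r))
          ≤ K * (2 ^ k * (2 * r)) ^ n * (2 ^ k * (2 * r) / b) ^ κ := h3.trans h4
        _ ≤ (K + C) * (2 ^ k * (2 * r)) ^ n * t ^ i := by gcongr; linarith
        _ = L * t ^ (k + 2 + i - k) * (2 ^ k * (2 * r)) ^ n := by
          rw [h6, hL, pow_add]; field_simp
    · have h1 := hgr z hz (2 ^ k * r) (by positivity)
      have h2 : C * (2 ^ k * r) ^ n ≤ C * (2 ^ k * (2 * r)) ^ n := by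
        gcongr
        linarith
      have h3 : C ≤ L * t ^ (N - k) := by
        have h4 : t ≤ t ^ (N - k) := by
          have : N - k = 0 ∨ N - k = 1 := by omega
          rcases this with h | h <;> rw [h] <;> simp [ht1.le]
        have h5 : 1 ≤ t⁻¹ := (one_le_inv₀ ht0).2 ht1.le
        calc C ≤ (K + C) * t⁻¹ := by nlinarith
          _ = L * t := by rw [hL]; field_simp
          _ ≤ _ := by gcongr
      calc _ ≤ C * (2 ^ k * (2 * r)) ^ n := h1.trans h2
        _ ≤ _ := by gcongr
  refine (Finset.sum_le_sum hterm).trans ?_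
  rw [← Finset.mul_sum]
  gcongr
  calc ∑ k ∈ Finset.Icc 1 N, t ^ (N - k) ≤ ∑ k ∈ Finset.range (N + 1), t ^ (N - k) := by
        apply Finset.sum_le_sum_of_subset_of_nonneg
        · intro k hk
          simp only [Finset.mem_Icc, Finset.mem_range] at *
          omega
        · intros; positivity
    _ = ∑ k ∈ Finset.range (N + 1), t ^ k := by
        rw [← Finset.sum_range_reflect]
        apply Finset.sum_congr rfl
        intro k hk
        rw [Finset.mem_range] at hk
        congr 1
        omega
    _ ≤ ∑' k, t ^ k := (summable_geometric_of_lt_one ht0.le ht1).sum_le_tsum _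
        (fun _ _ => by positivity)
    _ = (1 - t)⁻¹ := tsum_geometric_of_lt_one ht0.le ht1

theorem integrableOn_closedBall_sub_const (hf : LocallyIntegrable f μ) (x : E) (r c : ℝ) :
    IntegrableOn (fun y => f y - c) (closedBall x r) μ :=
  (hf.integrableOn_isCompact (isCompact_closedBall x r)).sub
    (integrableOn_const measure_closedBall_lt_top.ne)

theorem abs_ballAvg_sub_le (hf : LocallyIntegrable f μ) {x : E} (hx : BallsPos μ x) {r : ℝ}
    (hr : 0 < r) (c : ℝ) :
    μ.real (closedBall x r) * |ballAvg μ f x r - c| ≤ ∫ y in closedBall x r, |f y - c| ∂μ := by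
  have hm := hx.real_pos hr
  have h1 : ∫ y in closedBall x r, (f y - c) ∂μ =
      μ.real (closedBall x r) * (ballAvg μ f x r - c) := by
    rw [integral_sub (hf.integrableOn_isCompact (isCompact_closedBall x r))
      (integrableOn_const measure_closedBall_lt_top.ne), setIntegral_const, ballAvg, smul_eq_mul]
    field_simp
  calc _ = |∫ y in closedBall x r, (f y - c) ∂μ| := by rw [h1, abs_mul, abs_of_pos hm]
    _ ≤ _ := abs_integral_le_integral_abs

theorem ae_tendsto_ballAvg (hf : LocallyIntegrable f μ) :
    ∀ᵐ x ∂μ, Tendsto (fun r => ballAvg μ f x r) (𝓝[>] 0) (𝓝 (f x)) := by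
  filter_upwards [VitaliFamily.ae_tendsto_average (Besicovitch.vitaliFamily μ) hf] with x hx
  refine (hx.comp (Besicovitch.tendsto_filterAt μ x)).congr fun r => ?_
  simp [ballAvg, setAverage_eq]

theorem ae_lower_density : ∀ᵐ x ∂μ, ∃ c : ℝ, 0 < c ∧
    ∀ᶠ r in 𝓝[>] (0 : ℝ), c * r ^ Module.finrank ℝ E ≤ μ.real (closedBall x r) := by
  let ν : Measure E := Measure.addHaar
  filter_upwards [Besicovitch.ae_tendsto_rnDeriv ν μ, Measure.rnDeriv_lt_top ν μ, ae_ballsPos]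
    with x hx hlt hpos
  obtain ⟨L, hL1, hL2⟩ := ENNReal.lt_iff_exists_nnreal_btwn.1 hlt
  have hL0 : 0 < L := by
    have : (0 : ℝ≥0∞) < L := bot_le.trans_lt hL1
    exact_mod_cast this
  have hv : 0 < ν.real (ball 0 1) :=
    ENNReal.toReal_pos (measure_ball_pos ν 0 one_pos).ne' measure_ball_lt_top.ne
  refine ⟨ν.real (ball 0 1) / L, by positivity, ?_⟩
  filter_upwards [hx.eventually_lt_const hL1, self_mem_nhdsWithin] with r hr hr0
  rw [mem_Ioi] at hr0
  have h1 : ν (closedBall x r) ≤ L * μ (closedBall x r) := by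
    rw [ENNReal.div_lt_iff (Or.inl (hpos r hr0).ne') (Or.inl measure_closedBall_lt_top.ne)] at hr
    exact hr.le
  have h2 := ENNReal.toReal_mono (ENNReal.mul_ne_top ENNReal.coe_ne_top
    measure_closedBall_lt_top.ne) h1
  rw [ENNReal.toReal_mul, ENNReal.coe_toReal] at h2
  change ν.real (closedBall x r) ≤ L * μ.real (closedBall x r) at h2
  rw [Measure.addHaar_real_closedBall ν x hr0.le] at h2
  rw [div_mul_eq_mul_div, div_le_iff₀ (by positivity)]
  linarith

theorem ae_frequently_doubling (η : ℝ) : ∃ B : ℝ, 0 < B ∧ ∀ᵐ x ∂μ, ∀ s : ℝ, 0 < s →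
    ∃ᶠ j : ℕ in atTop, μ.real (closedBall x (η * (s / 2 ^ j))) ≤
      B * μ.real (closedBall x (s / 2 ^ j)) := by
  obtain ⟨p, hp⟩ := pow_unbounded_of_one_lt (max 1 η) (one_lt_two (α := ℝ))
  have hpη : η ≤ 2 ^ p := (le_max_right _ _).trans hp.le
  have hp0 : p ≠ 0 := by
    rintro rfl
    norm_num at hp
  obtain ⟨d, hd⟩ : ∃ d, d = Module.finrank ℝ E := ⟨_, rfl⟩
  refine ⟨2 * (2 ^ p) ^ d, by positivity, ?_⟩
  filter_upwards [ae_lower_density (μ := μ)] with x hx s hs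
  rw [← hd] at hx
  obtain ⟨c, hc, hcx⟩ := hx
  by_contra hcon
  rw [not_frequently] at hcon
  obtain ⟨j₀, hj₀⟩ := eventually_atTop.1 hcon
  have hstep : ∀ i : ℕ, (2 * (2 ^ p) ^ d) ^ i * μ.real (closedBall x (s / 2 ^ (j₀ + p * i))) ≤
      μ.real (closedBall x (s / 2 ^ j₀)) := by
    intro i
    induction i with
    | zero => simp
    | succ i ih =>
      refine le_trans ?_ ih
      rw [pow_succ, mul_assoc]
      gcongr
      refine (not_le.1 (hj₀ (j₀ + p * (i + 1)) (by omega))).le.trans ?_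
      apply real_closedBall_mono
      apply closedBall_subset_closedBall
      calc η * (s / 2 ^ (j₀ + p * (i + 1))) ≤ 2 ^ p * (s / 2 ^ (j₀ + p * (i + 1))) := by gcongr
        _ = s / 2 ^ (j₀ + p * i) := by
          rw [show j₀ + p * (i + 1) = p + (j₀ + p * i) by ring, pow_add 2 p]
          field_simp
  have htend : Tendsto (fun i : ℕ => s / 2 ^ (j₀ + p * i)) atTop (𝓝[>] 0) := by
    rw [tendsto_nhdsWithin_iff]
    refine ⟨?_, Eventually.of_forall fun i => ?_⟩
    · apply Tendsto.const_div_atTop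
      apply (tendsto_pow_atTop_atTop_of_one_lt (one_lt_two (α := ℝ))).comp
      apply tendsto_atTop_mono _ tendsto_id
      intro i
      have : 1 * i ≤ p * i := Nat.mul_le_mul_right i (by omega)
      simp only [id]
      omega
    · rw [mem_Ioi]; positivity
  have hev := htend.eventually hcx
  have hunb := (tendsto_pow_atTop_atTop_of_one_lt (one_lt_two (α := ℝ))).eventually_gt_atTop
    (μ.real (closedBall x (s / 2 ^ j₀)) / (c * (s / 2 ^ j₀) ^ d))
  obtain ⟨i, hi1, hi2⟩ := (hev.and hunb).exists
  rw [div_lt_iff₀ (by positivity)] at hi2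
  have h1 := hstep i
  have h2 : (2 * (2 ^ p) ^ d) ^ i * (c * (s / 2 ^ (j₀ + p * i)) ^ d) =
      2 ^ i * (c * (s / 2 ^ j₀) ^ d) := by
    rw [pow_add, pow_mul, mul_pow, div_pow, div_pow, mul_pow (2 ^ j₀ : ℝ),
      pow_right_comm (2 ^ p : ℝ) d i]
    field_simp
  have h3 : (2 * (2 ^ p) ^ d) ^ i * (c * (s / 2 ^ (j₀ + p * i)) ^ d) ≤
      (2 * (2 ^ p) ^ d) ^ i * μ.real (closedBall x (s / 2 ^ (j₀ + p * i))) := by gcongr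
  linarith

/-- Almost everywhere, `f` is close to its mean value over a doubling ball which is either small
or has no much smaller concentric doubling ball. -/
theorem exists_ae_doubling_close (hC : 0 < C) (hρ : 1 < ρ) (hβ : ρ ^ n < β)
    (hgr : BallGrowth μ n C) (η : ℝ) :
    ∃ D : ℝ, 0 < D ∧ ∀ f, BallRBMO μ n η ρ β f → ∀ᵐ x ∂μ, ∀ t : ℝ, 0 < t →
      ∃ s : ℝ, 0 < s ∧ BallDoubling μ ρ β x s ∧ |f x - ballAvg μ f x s| ≤ D ∧
        (s ≤ t ∨ ∀ s', 0 < s' → s' ≤ s / 2 → ¬ BallDoubling μ ρ β x s') := by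
  obtain ⟨B, hB, hBx⟩ := ae_frequently_doubling (μ := μ) η
  obtain ⟨_, _, _, -, -, -, hgood⟩ := exists_ballGood (η := η) hC hρ hβ hgr
  refine ⟨max 1 B, by positivity, fun f hf => ?_⟩
  filter_upwards [hBx, ae_tendsto_ballAvg hf.locallyIntegrable, ae_ballsPos] with x hxB hxf hx t ht
  by_cases hacc : ∀ ε : ℝ, 0 < ε → ∃ s, 0 < s ∧ s < ε ∧ BallDoubling μ ρ β x s
  · have hev : ∀ᶠ r in 𝓝[>] (0 : ℝ), |f x - ballAvg μ f x r| < 1 := by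
      filter_upwards [hxf.eventually (Metric.ball_mem_nhds (f x) one_pos)] with r hr
      rwa [dist_comm, Real.dist_eq] at hr
    obtain ⟨δ, hδ, hδr⟩ := mem_nhdsGT_iff_exists_Ioo_subset.1 hev
    rw [mem_Ioi] at hδ
    obtain ⟨s, hs0, hs, hsd⟩ := hacc (min δ t) (lt_min hδ ht)
    exact ⟨s, hs0, hsd, (hδr ⟨hs0, hs.trans_le (min_le_left _ _)⟩ : _ < _).le.trans
      (le_max_left _ _), Or.inl (hs.le.trans (min_le_right _ _))⟩
  · push Not at hacc
    obtain ⟨ε, hε, hεs⟩ := hacc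
    let S : Set ℝ := {s | 0 < s ∧ BallDoubling μ ρ β x s}
    obtain ⟨b, hb1, hb2, -⟩ := hgood x hx 1 one_pos
    have hS : S.Nonempty := ⟨b, by linarith, hb2.1⟩
    have hSb : BddBelow S := ⟨0, fun s hs => hs.1.le⟩
    have hσ : ε ≤ sInf S := le_csInf hS fun s hs => by
      by_contra hlt
      exact hεs s hs.1 (not_le.1 hlt) hs.2
    obtain ⟨s, ⟨hs0, hsd⟩, hs2⟩ := exists_lt_of_csInf_lt hS (by linarith : sInf S < 2 * sInf S)
    have hno : ∀ s', 0 < s' → s' ≤ s / 2 → ¬ BallDoubling μ ρ β x s' := by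
      intro s' hs' hs's hd
      have := csInf_le hSb (show s' ∈ S from ⟨hs', hd⟩)
      linarith
    refine ⟨s, hs0, hsd, ?_, Or.inr hno⟩
    have hfreq : ∃ᶠ j : ℕ in atTop,
        ballAvg μ f x (s / 2 ^ j) ∈ closedBall (ballAvg μ f x s) (max 1 B) := by
      refine (hxB s hs0).mono fun j hj => ?_
      have hr : 0 < s / 2 ^ j := by positivity
      have h2j : 2 ^ j * (s / 2 ^ j) = s := by field_simp
      have h1 := hf.oscillation x hx (s / 2 ^ j) hr j (by rwa [h2j]) (by
        intro i hij
        apply hno _ (by positivity)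
        obtain ⟨k, rfl⟩ := Nat.exists_eq_add_of_lt hij
        rw [show i + k + 1 = i + (k + 1) by ring, pow_add, pow_succ]
        have : (1 : ℝ) ≤ 2 ^ k := one_le_pow₀ one_le_two
        calc 2 ^ i * (s / (2 ^ i * (2 ^ k * 2))) = s / 2 / 2 ^ k := by field_simp
          _ ≤ s / 2 := div_le_self (by positivity) this)
      rw [h2j] at h1
      have h2 := abs_ballAvg_sub_le hf.locallyIntegrable hx hr (ballAvg μ f x s)
      rw [mem_closedBall, Real.dist_eq]
      refine le_trans ?_ (le_max_right _ _)
      refine le_of_mul_le_mul_left ?_ (hx.real_pos hr)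
      linarith
    have htend : Tendsto (fun j : ℕ => s / 2 ^ j) atTop (𝓝[>] 0) := by
      rw [tendsto_nhdsWithin_iff]
      exact ⟨(tendsto_pow_atTop_atTop_of_one_lt (one_lt_two (α := ℝ))).const_div_atTop s,
        Eventually.of_forall fun i => by rw [mem_Ioi]; positivity⟩
    have := isClosed_closedBall.mem_of_frequently_of_tendsto hfreq (hxf.comp htend)
    rwa [mem_closedBall, Real.dist_eq] at this

/-- Mean values of `f` over the smallest and the largest ball in a range of decay differ by at
most `D`. -/
def BallComparable {E : Type*} [PseudoMetricSpace E] [MeasurableSpace E] (μ : Measure E) (n : ℕ)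
    (ρ β K κ D : ℝ) (f : E → ℝ) : Prop :=
  ∀ x z, BallsPos μ x → BallsPos μ z →
    ∀ a b r : ℝ, 0 < a → BallDecay μ n K κ x a b → a ≤ 4 * r → dist z x ≤ r → 0 < b →
    closedBall z r ⊆ closedBall x b → BallDoubling μ ρ β z r → BallDoubling μ ρ β x b →
    |ballAvg μ f z r - ballAvg μ f x b| ≤ D

/-- Every ball is contained in a concentric good ball, with decay in between. -/
def HasGoodBalls {E : Type*} [PseudoMetricSpace E] [MeasurableSpace E] (μ : Measure E) (n : ℕ)
    (η ρ β B K κ : ℝ) : Prop :=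
  ∀ x, BallsPos μ x → ∀ a, 0 < a → ∃ b, a ≤ b ∧ BallGood μ η ρ β B x b ∧ BallDecay μ n K κ x a b

theorem BallComparable.concentric {D : ℝ} (hcmp : BallComparable μ n ρ β K κ D f) {x : E}
    (hx : BallsPos μ x) {a b r : ℝ} (ha : 0 < a) (hdec : BallDecay μ n K κ x a b)
    (har : a ≤ 4 * r) (hrb : r ≤ b) (hr : BallDoubling μ ρ β x r) (hb : BallDoubling μ ρ β x b) :
    |ballAvg μ f x r - ballAvg μ f x b| ≤ D := by
  have hr0 : 0 < r := by linarith
  exact hcmp x x hx hx a b r ha hdec har (by simpa using hr0.le) (hr0.trans_le hrb)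
    (closedBall_subset_closedBall hrb) hr hb

theorem BallComparable.abs_sub_le_of_lt {D : ℝ} (hgood : HasGoodBalls μ n η ρ β B K κ)
    (hcmp : BallComparable μ n ρ β K κ D f) {x y : E} (hx : BallsPos μ x) (hy : BallsPos μ y)
    {a b t : ℝ} (ht : 0 < t) (hxy : dist x y ≤ t) (hyt : BallDoubling μ ρ β y t) (ha : 0 < a)
    (hat : a ≤ 4 * t) (hdec : BallDecay μ n K κ x a b) (hxb : BallDoubling μ ρ β x b)
    (htb : t < b) :
    |ballAvg μ f x b - ballAvg μ f y t| ≤ 2 * D := by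
  rw [dist_comm] at hxy
  have hsub : ∀ c, 2 * t ≤ c → closedBall y t ⊆ closedBall x c := fun c hc =>
    closedBall_subset_closedBall' (by linarith)
  rcases le_or_gt (2 * t) b with hb | hb
  · have h := hcmp x y hx hy a b t ha hdec hat hxy (by linarith) (hsub b hb) hyt hxb
    have := (abs_nonneg _).trans h
    rw [abs_sub_comm]
    linarith
  · obtain ⟨c, htc, hc, hcd⟩ := hgood x hx (2 * t) (by linarith)
    have h1 := hcmp x y hx hy (2 * t) c t (by linarith) hcd (by linarith) hxy (by linarith)
      (hsub c htc) hyt hc.1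
    have h2 := hcmp.concentric hx (by linarith) hcd (by linarith) (by linarith) hxb hc.1
    rw [abs_sub_comm] at h1
    have := abs_sub_le (ballAvg μ f x b) (ballAvg μ f x c) (ballAvg μ f y t)
    linarith

/-- A stopping scale for `f` at `x` inside the ball `closedBall y t`. -/
def StopScale {E : Type*} [PseudoMetricSpace E] [MeasurableSpace E] (μ : Measure E)
    (η ρ β B L : ℝ) (f : E → ℝ) (y : E) (t : ℝ) (x : E) (s : ℝ) : Prop :=
  0 < s ∧ s ≤ t ∧ BallGood μ η ρ β B x s ∧ L < |ballAvg μ f x s - ballAvg μ f y t|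

theorem abs_sub_le_of_no_stopScale {D D' L : ℝ} (hgood : HasGoodBalls μ n η ρ β B K κ)
    (hcmp : BallComparable μ n ρ β K κ D f) {x y : E} (hx : BallsPos μ x) (hy : BallsPos μ y)
    {t : ℝ} (ht : 0 < t) (hxy : dist x y ≤ t) (hyt : BallDoubling μ ρ β y t) (hL : 0 ≤ L)
    (hclose : ∃ s : ℝ, 0 < s ∧ BallDoubling μ ρ β x s ∧ |f x - ballAvg μ f x s| ≤ D' ∧
        (s ≤ t ∨ ∀ s', 0 < s' → s' ≤ s / 2 → ¬ BallDoubling μ ρ β x s'))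
    (hno : ∀ s, ¬ StopScale μ η ρ β B L f y t x s) :
    |f x - ballAvg μ f y t| ≤ L + 4 * D + D' := by
  obtain ⟨s, hs, hxs, hfs, hst⟩ := hclose
  obtain ⟨b, hab, hb, hdec⟩ := hgood x hx (min s t) (lt_min hs ht)
  have hm : 0 < min s t := lt_min hs ht
  have hb0 : 0 < b := hm.trans_le hab
  have hD : 0 ≤ D := (abs_nonneg _).trans (hcmp.concentric hx hm hdec (by linarith) le_rfl hb.1 hb.1)
  have h1 : |ballAvg μ f x s - ballAvg μ f x b| ≤ 2 * D := by
    rcases le_or_gt s b with hsb | hsb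
    · have := hcmp.concentric hx hm hdec (by linarith [min_le_left s t]) hsb hxs hb.1
      linarith
    · have hst' : ¬ s ≤ t := fun h => by
        rw [min_eq_left h] at hab
        linarith
      have hb2 : s / 2 < b := by
        by_contra h
        exact hst.resolve_left hst' b hb0 (not_lt.1 h) hb.1
      obtain ⟨c, hsc, hc, hcd⟩ := hgood x hx s hs
      have h2 := hcmp.concentric hx hs hcd (by linarith) hsc hxs hc.1
      have h3 := hcmp.concentric hx hs hcd (by linarith) (by linarith) hb.1 hc.1
      rw [abs_sub_comm] at h3
      have := abs_sub_le (ballAvg μ f x s) (ballAvg μ f x c) (ballAvg μ f x b)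
      linarith
  have h2 : |ballAvg μ f x b - ballAvg μ f y t| ≤ L + 2 * D := by
    rcases le_or_gt b t with hbt | hbt
    · have := not_lt.1 fun h => hno b ⟨hb0, hbt, hb, h⟩
      linarith
    · have := hcmp.abs_sub_le_of_lt hgood hx hy ht hxy hyt hm (by linarith [min_le_right s t]) hdec
        hb.1 hbt
      linarith
  have h3 := abs_sub_le (f x) (ballAvg μ f x s) (ballAvg μ f y t)
  have h4 := abs_sub_le (ballAvg μ f x s) (ballAvg μ f x b) (ballAvg μ f y t)
  linarith

/-- If there is a stopping scale, there is an almost maximal one, for which the mean value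
of `f` is controlled. -/
theorem exists_stopScale {D L : ℝ} (hgood : HasGoodBalls μ n η ρ β B K κ)
    (hcmp : BallComparable μ n ρ β K κ D f) {x y : E} (hx : BallsPos μ x) (hy : BallsPos μ y)
    {t : ℝ} (hxy : dist x y ≤ t) (hyt : BallDoubling μ ρ β y t)
    (hexists : ∃ s, StopScale μ η ρ β B L f y t x s) (hL : 0 ≤ L) :
    ∃ s, StopScale μ η ρ β B L f y t x s ∧
      |ballAvg μ f x s - ballAvg μ f y t| ≤ L + 4 * D := by
  have hbdd : BddAbove {s | StopScale μ η ρ β B L f y t x s} := ⟨t, fun s hs => hs.2.1⟩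
  obtain ⟨s₀, hs₀⟩ := hexists
  have hpos := hs₀.1.trans_le (le_csSup hbdd hs₀)
  obtain ⟨s, hs, hsup⟩ := exists_lt_of_lt_csSup ⟨s₀, hs₀⟩ (half_lt_self hpos)
  refine ⟨s, hs, ?_⟩
  obtain ⟨hs0, hst, hsg, -⟩ := hs
  have h4 : 0 < 4 * s := by linarith
  obtain ⟨b, hsb, hb, hdec⟩ := hgood x hx (4 * s) h4
  have h1 := hcmp.concentric hx h4 hdec le_rfl (by linarith) hsg.1 hb.1
  have h0 := (abs_nonneg _).trans h1
  have h2 : |ballAvg μ f x b - ballAvg μ f y t| ≤ L + 2 * D := by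
    rcases le_or_gt b t with hbt | hbt
    · have : |ballAvg μ f x b - ballAvg μ f y t| ≤ L := not_lt.1 fun h => by
        have := le_csSup hbdd (show b ∈ {s | StopScale μ η ρ β B L f y t x s} from
          ⟨by linarith, hbt, hb, h⟩)
        linarith
      linarith
    · have := hcmp.abs_sub_le_of_lt hgood hx hy (hs0.trans_le hst) hxy hyt h4 (by linarith) hdec
        hb.1 hbt
      linarith
  have := abs_sub_le (ballAvg μ f x s) (ballAvg μ f x b) (ballAvg μ f y t)
  linarith

theorem exists_besicovitch_families (E : Type*) [NormedAddCommGroup E] [NormedSpace ℝ E]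
    [FiniteDimensional ℝ E] :
    ∃ N : ℕ, ∀ (S : Set E) (r : E → ℝ) (R : ℝ), (∀ x ∈ S, 0 < r x ∧ r x ≤ R) →
      ∃ s : Fin N → Set E, (∀ i, s i ⊆ S) ∧ (∀ i, (s i).Countable) ∧
        (∀ i, (s i).PairwiseDisjoint fun x => closedBall x (r x)) ∧
        ∀ x ∈ S, ∃ i, ∃ z ∈ s i, x ∈ closedBall z (r z) := by
  obtain ⟨N, τ, hτ, hN⟩ := HasBesicovitchCovering.no_satelliteConfig (α := E)
  refine ⟨N, fun S r R hr => ?_⟩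
  let q : Besicovitch.BallPackage S E :=
    { c := Subtype.val
      r := fun x => r x
      rpos := fun x => (hr x x.2).1
      r_bound := R
      r_le := fun x => (hr x x.2).2 }
  obtain ⟨s, hs, hcov⟩ := Besicovitch.exist_disjoint_covering_families hτ hN q
  have hdisj : ∀ i, (Subtype.val '' s i).PairwiseDisjoint fun x => closedBall x (r x) := by
    rintro i _ ⟨x, hx, rfl⟩ _ ⟨z, hz, rfl⟩ hxz
    exact hs i hx hz fun h => hxz (by rw [h])
  refine ⟨fun i => Subtype.val '' s i, fun i => Subtype.coe_image_subset _ _, fun i => ?_, hdisj,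
    fun x hx => ?_⟩
  · have := FiniteDimensional.proper ℝ E
    refine (hdisj i).countable_of_nonempty_interior ?_
    rintro _ ⟨x, -, rfl⟩
    exact ⟨x, ball_subset_interior_closedBall (mem_ball_self (hr x x.2).1)⟩
  · obtain ⟨i, hi⟩ := mem_iUnion.1 (hcov ⟨⟨x, hx⟩, rfl⟩)
    simp only [mem_iUnion] at hi
    obtain ⟨z, hz, hxz⟩ := hi
    exact ⟨i, z, ⟨z, hz, rfl⟩, ball_subset_closedBall hxz⟩

/-- On a good ball, `f` deviates from its mean value by at most the measure of the dilated ball. -/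
theorem BallRBMO.oscillation_of_doubling (hf : BallRBMO μ n η ρ β f) {x : E} (hx : BallsPos μ x)
    {r : ℝ} (hr : 0 < r) (hd : BallDoubling μ ρ β x r) :
    ∫ y in closedBall x r, |f y - ballAvg μ f x r| ∂μ ≤ μ.real (closedBall x (η * r)) := by
  have := hf.oscillation x hx r hr 0 (by simpa using hd) (by simp)
  simpa using this

theorem ofReal_mul_measure_half_le {L : ℝ} (hf : BallRBMO μ n η ρ β f) {x : E}
    (hx : BallsPos μ x) {s m : ℝ} (hs : 0 < s) (hg : BallGood μ η ρ β B x s)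
    (hL : L < |ballAvg μ f x s - m|) :
    ENNReal.ofReal (L - B) * μ (closedBall x (s / 2)) ≤
      ∫⁻ y in closedBall x (s / 2), ‖f y - m‖ₑ ∂μ := by
  have hint := integrableOn_closedBall_sub_const hf.locallyIntegrable x
  have h1 : ∫ y in closedBall x (s / 2), |f y - ballAvg μ f x s| ∂μ ≤
      B * μ.real (closedBall x (s / 2)) := by
    refine le_trans ?_ ((hf.oscillation_of_doubling hx hs hg.1).trans hg.2)
    exact setIntegral_mono_set (hint s _).abs (Eventually.of_forall fun _ => abs_nonneg _)
      (closedBall_subset_closedBall (by linarith)).eventuallyLE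
  have h2 : L * μ.real (closedBall x (s / 2)) ≤
      ∫ y in closedBall x (s / 2), (|f y - ballAvg μ f x s| + |f y - m|) ∂μ := by
    have : ∫ _ in closedBall x (s / 2), L ∂μ = L * μ.real (closedBall x (s / 2)) := by
      rw [setIntegral_const, smul_eq_mul, mul_comm]
    rw [← this]
    refine integral_mono (integrableOn_const measure_closedBall_lt_top.ne)
      ((hint _ _).abs.add (hint _ _).abs) fun y => ?_
    have := abs_sub_le (ballAvg μ f x s) (f y) m
    rw [abs_sub_comm (ballAvg μ f x s) (f y)] at this
    change L ≤ _
    linarith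
  rw [integral_add (hint _ _).abs (hint _ _).abs] at h2
  have h3 : (L - B) * μ.real (closedBall x (s / 2)) ≤
      ∫ y in closedBall x (s / 2), ‖f y - m‖ ∂μ := by
    simp only [Real.norm_eq_abs]
    linarith
  rw [← ofReal_integral_norm_eq_lintegral_enorm (hint _ _), ← ofReal_measureReal
    measure_closedBall_lt_top.ne, ← ENNReal.ofReal_mul' measureReal_nonneg]
  exact ENNReal.ofReal_le_ofReal h3

theorem tsum_measure_le_of_stopScale {L : ℝ} (hf : BallRBMO μ n η ρ β f) (hη : 1 < η) (hB : 0 < B)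
    (hL : B < L) {y : E} (hy : BallsPos μ y) {t : ℝ} (ht : 0 < t) (hg : BallGood μ η ρ β B y t)
    {s : Set E} (hs : s.Countable) {σ : E → ℝ}
    (hst : ∀ x ∈ s, BallsPos μ x ∧ x ∈ closedBall y (t / 2) ∧ StopScale μ η ρ β B L f y t x (σ x))
    (hdisj : s.PairwiseDisjoint fun x => closedBall x (σ x / 2)) :
    ∑' x : s, μ (closedBall (x : E) (σ x)) ≤
      ENNReal.ofReal (B ^ 2 / (L - B)) * μ (closedBall y t) := by
  have hLB : 0 < L - B := by linarith
  have hball : ∀ x : s, μ (closedBall (x : E) (σ x)) ≤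
      ENNReal.ofReal (B / (L - B)) *
        ∫⁻ z in closedBall (x : E) (σ x / 2), ‖f z - ballAvg μ f y t‖ₑ ∂μ := by
    intro x
    obtain ⟨hx, -, hσ, -, hxg, hxL⟩ := hst x x.2
    have h1 := ofReal_mul_measure_half_le hf hx hσ hxg hxL
    have h2 : μ (closedBall (x : E) (σ x)) ≤
        ENNReal.ofReal B * μ (closedBall (x : E) (σ x / 2)) := by
      rw [← ofReal_measureReal measure_closedBall_lt_top.ne, ← ofReal_measureReal
        measure_closedBall_lt_top.ne, ← ENNReal.ofReal_mul hB.le]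
      refine ENNReal.ofReal_le_ofReal (le_trans (real_closedBall_mono ?_) hxg.2)
      exact closedBall_subset_closedBall (by nlinarith)
    calc _ ≤ _ := h2
      _ = ENNReal.ofReal (B / (L - B)) *
          (ENNReal.ofReal (L - B) * μ (closedBall (x : E) (σ x / 2))) := by
        rw [← mul_assoc, ← ENNReal.ofReal_mul (by positivity), div_mul_cancel₀ _ hLB.ne']
      _ ≤ _ := by gcongr
  have hsum : ∑' x : s, ∫⁻ z in closedBall (x : E) (σ x / 2), ‖f z - ballAvg μ f y t‖ₑ ∂μ ≤
      ENNReal.ofReal B * μ (closedBall y t) := by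
    rw [← lintegral_biUnion (s := fun x => closedBall x (σ x / 2)) hs
      (fun _ _ => measurableSet_closedBall) hdisj]
    calc _ ≤ ∫⁻ z in closedBall y t, ‖f z - ballAvg μ f y t‖ₑ ∂μ := by
          refine lintegral_mono_set (iUnion₂_subset fun x hx => ?_)
          obtain ⟨-, hxy, -, hσt, -⟩ := hst x hx
          rw [mem_closedBall] at hxy
          exact closedBall_subset_closedBall' (by linarith)
      _ ≤ _ := by
        rw [← ofReal_integral_norm_eq_lintegral_enorm
          (integrableOn_closedBall_sub_const hf.locallyIntegrable y t _), ← ofReal_measureReal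
          measure_closedBall_lt_top.ne, ← ENNReal.ofReal_mul hB.le]
        refine ENNReal.ofReal_le_ofReal ?_
        refine ((hf.oscillation_of_doubling hy ht hg.1).trans hg.2).trans ?_
        exact mul_le_mul_of_nonneg_left
          (real_closedBall_mono (closedBall_subset_closedBall (by linarith))) hB.le
  calc _ ≤ ∑' x : s, ENNReal.ofReal (B / (L - B)) *
        ∫⁻ z in closedBall (x : E) (σ x / 2), ‖f z - ballAvg μ f y t‖ₑ ∂μ :=
        ENNReal.tsum_le_tsum hball
    _ ≤ ENNReal.ofReal (B / (L - B)) * (ENNReal.ofReal B * μ (closedBall y t)) := by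
      rw [ENNReal.tsum_mul_left]
      gcongr
    _ = _ := by
      rw [← mul_assoc, ← ENNReal.ofReal_mul (by positivity)]
      congr 2
      field_simp

/-- The a.e. control of `f` by mean values over doubling balls which are not too large. -/
def DoublingClose {E : Type*} [PseudoMetricSpace E] [MeasurableSpace E] (μ : Measure E)
    (ρ β D : ℝ) (f : E → ℝ) : Prop :=
  ∀ᵐ x ∂μ, ∀ t : ℝ, 0 < t → ∃ s : ℝ, 0 < s ∧ BallDoubling μ ρ β x s ∧
    |f x - ballAvg μ f x s| ≤ D ∧ (s ≤ t ∨ ∀ s', 0 < s' → s' ≤ s / 2 → ¬ BallDoubling μ ρ β x s')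

/-- Calderón–Zygmund decomposition of a good ball into good stopping balls. -/
theorem exists_stopping_families {N : ℕ}
    (hN : ∀ (S : Set E) (r : E → ℝ) (R : ℝ), (∀ x ∈ S, 0 < r x ∧ r x ≤ R) →
      ∃ s : Fin N → Set E, (∀ i, s i ⊆ S) ∧ (∀ i, (s i).Countable) ∧
        (∀ i, (s i).PairwiseDisjoint fun x => closedBall x (r x)) ∧
        ∀ x ∈ S, ∃ i, ∃ z ∈ s i, x ∈ closedBall z (r z))
    (hgood : HasGoodBalls μ n η ρ β B K κ) (hη : 1 < η) (hB : 0 < B) {D D' L : ℝ}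
    (hD' : 0 ≤ D') (hL : B < L) (hf : BallRBMO μ n η ρ β f) (hcmp : BallComparable μ n ρ β K κ D f)
    (hclose : DoublingClose μ ρ β D' f) {y : E} (hy : BallsPos μ y) {t : ℝ} (ht : 0 < t)
    (hg : BallGood μ η ρ β B y t) :
    ∃ (s : Fin N → Set E) (σ : E → ℝ), (∀ i, (s i).Countable) ∧
      (∀ i, ∀ x ∈ s i, BallsPos μ x ∧ 0 < σ x ∧ BallGood μ η ρ β B x (σ x) ∧
        |ballAvg μ f x (σ x) - ballAvg μ f y t| ≤ L + 4 * D + D') ∧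
      (∀ i, ∑' x : s i, μ (closedBall (x : E) (σ x)) ≤
        ENNReal.ofReal (B ^ 2 / (L - B)) * μ (closedBall y t)) ∧
      ∀ᵐ x ∂μ, x ∈ closedBall y (t / 2) →
        |f x - ballAvg μ f y t| ≤ L + 4 * D + D' ∨ ∃ i, ∃ z ∈ s i, x ∈ closedBall z (σ z / 2) := by
  have hL0 : 0 ≤ L := by linarith
  have hdist : ∀ {x}, x ∈ closedBall y (t / 2) → dist x y ≤ t := fun {x} hx => by
    rw [mem_closedBall] at hx
    linarith
  let S : Set E := {x | BallsPos μ x ∧ x ∈ closedBall y (t / 2) ∧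
    ∃ s, StopScale μ η ρ β B L f y t x s}
  have hS : ∀ x ∈ S, ∃ s, StopScale μ η ρ β B L f y t x s ∧
      |ballAvg μ f x s - ballAvg μ f y t| ≤ L + 4 * D := fun x hx =>
    exists_stopScale hgood hcmp hx.1 hy (hdist hx.2.1) hg.1 hx.2.2 hL0
  choose! σ hσ using hS
  obtain ⟨s, hsS, hsc, hsd, hcov⟩ := hN S (fun x => σ x / 2) (t / 2) fun x hx =>
    ⟨by linarith [(hσ x hx).1.1], by linarith [(hσ x hx).1.2.1]⟩
  refine ⟨s, σ, hsc, fun i x hx => ?_, fun i => ?_, ?_⟩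
  · have h := hσ x (hsS i hx)
    exact ⟨(hsS i hx).1, h.1.1, h.1.2.2.1, by linarith [h.2]⟩
  · refine tsum_measure_le_of_stopScale hf hη hB hL hy ht hg (hsc i) (fun x hx => ?_) (hsd i)
    have hx' := hsS i hx
    exact ⟨hx'.1, hx'.2.1, (hσ x hx').1⟩
  · filter_upwards [hclose, ae_ballsPos] with x hxc hx hxy
    by_cases hxS : x ∈ S
    · exact Or.inr (hcov x hxS)
    · refine Or.inl (abs_sub_le_of_no_stopScale hgood hcmp hx hy ht (hdist hxy) hg.1 hL0
        (hxc t ht) fun s' hs' => hxS ⟨hx, hxy, s', hs'⟩)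

/-- The truncated exponential of the oscillation of `f` around its mean value over a ball. -/
def truncExp {E : Type*} [PseudoMetricSpace E] [MeasurableSpace E] (μ : Measure E) (f : E → ℝ)
    (c : ℝ) (T : ℝ≥0∞) (y : E) (t : ℝ) (x : E) : ℝ≥0∞ :=
  min (ENNReal.ofReal (Real.exp (c * |f x - ballAvg μ f y t|))) T

theorem aemeasurable_truncExp (hf : LocallyIntegrable f μ) (c : ℝ) (T : ℝ≥0∞) (y : E) (t : ℝ) :
    AEMeasurable (truncExp μ f c T y t) μ := by
  have := hf.aestronglyMeasurable.aemeasurable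
  unfold truncExp
  fun_prop

theorem truncExp_le {c : ℝ} (hc : 0 ≤ c) (T : ℝ≥0∞) {y z : E} {s t L : ℝ}
    (h : |ballAvg μ f z s - ballAvg μ f y t| ≤ L) (hcL : Real.exp (c * L) ≤ 2) (x : E) :
    truncExp μ f c T y t x ≤ 2 * truncExp μ f c T z s x := by
  unfold truncExp
  have h1 : Real.exp (c * |f x - ballAvg μ f y t|) ≤
      2 * Real.exp (c * |f x - ballAvg μ f z s|) := by
    calc _ ≤ Real.exp (c * L + c * |f x - ballAvg μ f z s|) := by
          rw [← mul_add]
          gcongr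
          have := abs_sub_le (f x) (ballAvg μ f z s) (ballAvg μ f y t)
          linarith
      _ ≤ _ := by
          rw [Real.exp_add]
          gcongr
  have h2 := ENNReal.ofReal_le_ofReal h1
  rw [ENNReal.ofReal_mul two_pos.le, ENNReal.ofReal_ofNat] at h2
  rw [mul_min]
  refine le_min ((min_le_left _ _).trans h2) ((min_le_right _ _).trans ?_)
  exact le_mul_of_one_le_left' one_le_two

theorem lintegral_truncExp_step {N : ℕ}
    (hN : ∀ (S : Set E) (r : E → ℝ) (R : ℝ), (∀ x ∈ S, 0 < r x ∧ r x ≤ R) →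
      ∃ s : Fin N → Set E, (∀ i, s i ⊆ S) ∧ (∀ i, (s i).Countable) ∧
        (∀ i, (s i).PairwiseDisjoint fun x => closedBall x (r x)) ∧
        ∀ x ∈ S, ∃ i, ∃ z ∈ s i, x ∈ closedBall z (r z))
    (hgood : HasGoodBalls μ n η ρ β B K κ) (hη : 1 < η) (hB : 0 < B) {D D' L c : ℝ}
    (hD' : 0 ≤ D') (hL : B < L) (hNL : N * (B ^ 2 / (L - B)) ≤ 1 / 4) (hc : 0 ≤ c)
    (hcL : Real.exp (c * (L + 4 * D + D')) ≤ 2)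
    (hf : BallRBMO μ n η ρ β f) (hcmp : BallComparable μ n ρ β K κ D f)
    (hclose : DoublingClose μ ρ β D' f) {T X : ℝ≥0∞}
    (hX : ∀ y t, BallsPos μ y → 0 < t → BallGood μ η ρ β B y t →
      ∫⁻ x in closedBall y (t / 2), truncExp μ f c T y t x ∂μ ≤ X * μ (closedBall y t))
    {y : E} {t : ℝ} (hy : BallsPos μ y) (ht : 0 < t) (hg : BallGood μ η ρ β B y t) :
    ∫⁻ x in closedBall y (t / 2), truncExp μ f c T y t x ∂μ ≤
      (2 + X * 2⁻¹) * μ (closedBall y t) := by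
  obtain ⟨s, σ, hsc, hs, hsum, hcov⟩ :=
    exists_stopping_families hN hgood hη hB hD' hL hf hcmp hclose hy ht hg
  let F : Fin N → E → ℝ≥0∞ := fun i x => ∑' z : s i,
    (closedBall (z : E) (σ z / 2)).indicator (fun w => 2 * truncExp μ f c T z (σ z) w) x
  have hmeas : ∀ z : E, AEMeasurable ((closedBall z (σ z / 2)).indicator
      (fun w => 2 * truncExp μ f c T z (σ z) w)) μ := fun z =>
    ((aemeasurable_truncExp hf.locallyIntegrable c T z (σ z)).const_mul 2).indicator
      measurableSet_closedBall
  have hFmeas : ∀ i, AEMeasurable (F i) μ := fun i => by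
    have := (hsc i).to_subtype
    exact AEMeasurable.tsum fun z => hmeas z
  have hpt : ∀ᵐ x ∂μ, x ∈ closedBall y (t / 2) → truncExp μ f c T y t x ≤ 2 + ∑ i, F i x := by
    filter_upwards [hcov] with x hx hxy
    rcases hx hxy with h | ⟨i, z, hz, hxz⟩
    · refine le_trans ((min_le_left _ _).trans ?_) le_self_add
      rw [← ENNReal.ofReal_ofNat 2]
      refine ENNReal.ofReal_le_ofReal (le_trans ?_ hcL)
      gcongr
    · calc truncExp μ f c T y t x ≤ 2 * truncExp μ f c T z (σ z) x :=
            truncExp_le hc T (hs i z hz).2.2.2 hcL x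
        _ = (closedBall z (σ z / 2)).indicator (fun w => 2 * truncExp μ f c T z (σ z) w) x := by
            rw [indicator_of_mem hxz]
        _ ≤ F i x := ENNReal.le_tsum (f := fun z : s i => (closedBall (z : E) (σ z / 2)).indicator
            (fun w => 2 * truncExp μ f c T z (σ z) w) x) ⟨z, hz⟩
        _ ≤ ∑ i, F i x := Finset.single_le_sum (f := fun i => F i x) (fun _ _ => zero_le)
            (Finset.mem_univ i)
        _ ≤ _ := le_add_self
  have hFi : ∀ i, ∫⁻ x, F i x ∂μ ≤
      2 * X * (ENNReal.ofReal (B ^ 2 / (L - B)) * μ (closedBall y t)) := by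
    intro i
    have := (hsc i).to_subtype
    calc ∫⁻ x, F i x ∂μ = ∑' z : s i, ∫⁻ x, (closedBall (z : E) (σ z / 2)).indicator
          (fun w => 2 * truncExp μ f c T z (σ z) w) x ∂μ := lintegral_tsum fun z => hmeas z
      _ ≤ ∑' z : s i, 2 * X * μ (closedBall (z : E) (σ z)) := by
        refine ENNReal.tsum_le_tsum fun z => ?_
        obtain ⟨hz, hσ, hzg, -⟩ := hs i z z.2
        rw [lintegral_indicator measurableSet_closedBall, lintegral_const_mul'' _
          (aemeasurable_truncExp hf.locallyIntegrable c T _ _).restrict, mul_assoc]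
        gcongr
        exact hX z (σ z) hz hσ hzg
      _ ≤ _ := by
        rw [ENNReal.tsum_mul_left]
        gcongr
        exact hsum i
  have hquarter : 2 * X * (N * (ENNReal.ofReal (B ^ 2 / (L - B)) * μ (closedBall y t))) ≤
      X * 2⁻¹ * μ (closedBall y t) := by
    have h1 : 2 * ((N : ℝ≥0∞) * ENNReal.ofReal (B ^ 2 / (L - B))) ≤ 2⁻¹ := by
      rw [← ENNReal.ofReal_natCast, ← ENNReal.ofReal_mul (by positivity), ← ENNReal.ofReal_ofNat 2,
        ← ENNReal.ofReal_mul two_pos.le, ← ENNReal.ofReal_inv_of_pos two_pos]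
      exact ENNReal.ofReal_le_ofReal (by linarith)
    calc _ = X * (2 * ((N : ℝ≥0∞) * ENNReal.ofReal (B ^ 2 / (L - B)))) * μ (closedBall y t) := by
          ring
      _ ≤ _ := by gcongr
  calc _ ≤ ∫⁻ x in closedBall y (t / 2), (2 + ∑ i, F i x) ∂μ :=
        setLIntegral_mono_ae' measurableSet_closedBall hpt
    _ = 2 * μ (closedBall y (t / 2)) + ∑ i, ∫⁻ x in closedBall y (t / 2), F i x ∂μ := by
        rw [lintegral_add_left measurable_const, setLIntegral_const,
          lintegral_finsetSum' _ fun i _ => (hFmeas i).restrict]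
    _ ≤ 2 * μ (closedBall y t) + ∑ i : Fin N,
          2 * X * (ENNReal.ofReal (B ^ 2 / (L - B)) * μ (closedBall y t)) := by
        gcongr with i
        · linarith
        · exact (setLIntegral_le_lintegral _ _).trans (hFi i)
    _ ≤ _ := by
        rw [Finset.sum_const, Finset.card_univ, Fintype.card_fin, nsmul_eq_mul, add_mul,
          mul_left_comm]
        gcongr

/-- John–Nirenberg inequality on good balls. -/
theorem exists_lintegral_exp_le (hgood : HasGoodBalls μ n η ρ β B K κ) (hη : 1 < η) (hB : 0 < B)
    {D D' : ℝ} (hD : 0 ≤ D) (hD' : 0 ≤ D') :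
    ∃ c : ℝ, 0 < c ∧ ∀ f, BallRBMO μ n η ρ β f → BallComparable μ n ρ β K κ D f →
      DoublingClose μ ρ β D' f → ∀ y t, BallsPos μ y → 0 < t → BallGood μ η ρ β B y t →
      ∫⁻ x in closedBall y (t / 2), ENNReal.ofReal (Real.exp (c * |f x - ballAvg μ f y t|)) ∂μ ≤
        4 * μ (closedBall y t) := by
  obtain ⟨N, hN⟩ := exists_besicovitch_families E
  obtain ⟨L, hL⟩ : ∃ L, L = B + 4 * B ^ 2 * (N + 1) := ⟨_, rfl⟩
  have hLB : B < L := by rw [hL]; linarith [show 0 < 4 * B ^ 2 * (N + 1) by positivity]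
  have hNL : N * (B ^ 2 / (L - B)) ≤ 1 / 4 := by
    rw [hL, add_sub_cancel_left, ← mul_div_assoc, div_le_div_iff₀ (by positivity) (by norm_num)]
    nlinarith [sq_nonneg B]
  have hM : 0 < L + 4 * D + D' := by linarith
  have hc : 0 < Real.log 2 / (L + 4 * D + D') := div_pos (Real.log_pos one_lt_two) hM
  obtain ⟨c, hcdef⟩ : ∃ c, c = Real.log 2 / (L + 4 * D + D') := ⟨_, rfl⟩
  rw [← hcdef] at hc
  have hcL : Real.exp (c * (L + 4 * D + D')) ≤ 2 := by
    rw [hcdef, div_mul_cancel₀ _ hM.ne', Real.exp_log two_pos]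
  refine ⟨c, hc, fun f hf hcmp hclose y t hy ht hg => ?_⟩
  have hiter : ∀ (T : ℝ≥0∞) (k : ℕ), ∀ y t, BallsPos μ y → 0 < t → BallGood μ η ρ β B y t →
      ∫⁻ x in closedBall y (t / 2), truncExp μ f c T y t x ∂μ ≤
        (4 + T * 2⁻¹ ^ k) * μ (closedBall y t) := by
    intro T k
    induction k with
    | zero =>
      intro y t hy ht hg
      calc _ ≤ ∫⁻ _ in closedBall y (t / 2), T ∂μ := lintegral_mono fun x => min_le_right _ _
        _ = T * μ (closedBall y (t / 2)) := setLIntegral_const _ _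
        _ ≤ _ := by
          rw [pow_zero, mul_one]
          gcongr
          · exact le_add_self
          · linarith
    | succ k ih =>
      intro y t hy ht hg
      refine (lintegral_truncExp_step hN hgood hη hB hD' hLB hNL hc.le hcL hf hcmp hclose ih
        hy ht hg).trans_eq ?_
      congr 1
      rw [add_mul, pow_succ, ← add_assoc, mul_assoc]
      congr 1
      rw [show (4 : ℝ≥0∞) = 2 * 2 by norm_num, mul_assoc,
        ENNReal.mul_inv_cancel two_ne_zero ENNReal.ofNat_ne_top]
      norm_num
  have htrunc : ∀ T : ℝ≥0∞, T ≠ ∞ → ∫⁻ x in closedBall y (t / 2), truncExp μ f c T y t x ∂μ ≤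
      4 * μ (closedBall y t) := by
    intro T hT
    have h1 : Tendsto (fun k : ℕ => (4 + T * 2⁻¹ ^ k) * μ (closedBall y t)) atTop
        (𝓝 ((4 + T * 0) * μ (closedBall y t))) := by
      refine ENNReal.Tendsto.mul_const (tendsto_const_nhds.add (ENNReal.Tendsto.const_mul
        (ENNReal.tendsto_pow_atTop_nhds_zero_of_lt_one ?_) (Or.inr hT)))
        (Or.inr measure_closedBall_lt_top.ne)
      exact ENNReal.inv_lt_one.2 ENNReal.one_lt_two
    rw [mul_zero, add_zero] at h1
    exact ge_of_tendsto' h1 fun k => hiter T k y t hy ht hg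
  have hsup : ∀ x, ENNReal.ofReal (Real.exp (c * |f x - ballAvg μ f y t|)) =
      ⨆ m : ℕ, truncExp μ f c m y t x := fun x => by
    unfold truncExp
    rw [← inf_iSup_eq, ENNReal.iSup_natCast, inf_top_eq]
  simp_rw [hsup]
  rw [lintegral_iSup' (fun m => (aemeasurable_truncExp hf.locallyIntegrable c m y t).restrict)
    (Eventually.of_forall fun x m m' h => min_le_min_left _ (by exact_mod_cast h))]
  exact iSup_le fun m => htrunc m (ENNReal.natCast_ne_top m)

/-- Ranges of decay are at most polynomially long. -/
theorem exists_measure_le_of_decay (hC : 0 < C) (hK : 0 < K) (hκ : 0 < κ) (hgr : BallGrowth μ n C)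
    {x : E} (hx : BallsPos μ x) {w : ℝ} (hw : 0 < w) :
    ∃ (A : ℝ) (p : ℕ), 0 < A ∧ ∀ (j : ℕ) (b : ℝ), 2 ^ (j + 1) * w ≤ b →
      BallDecay μ n K κ x (2 ^ (j + 1) * w) b → μ.real (closedBall x b) ≤ A * (2 ^ j) ^ p := by
  obtain ⟨m, hm⟩ : ∃ m, m = μ.real (closedBall x w) := ⟨_, rfl⟩
  have hm0 : 0 < m := hm ▸ hx.real_pos hw
  obtain ⟨q, hq⟩ := exists_nat_ge (1 / κ)
  obtain ⟨Y, hY⟩ : ∃ Y, Y = K * (2 * w) ^ n / m + 1 := ⟨_, rfl⟩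
  have hY1 : 1 ≤ Y := by
    rw [hY]
    have : 0 < K * (2 * w) ^ n / m := by positivity
    linarith
  refine ⟨C * (2 * w * Y ^ q) ^ n, n * (1 + n * q), by positivity, fun j b hb hdec => ?_⟩
  obtain ⟨a, ha⟩ : ∃ a : ℝ, a = 2 ^ (j + 1) * w := ⟨_, rfl⟩
  have h2j : (1 : ℝ) ≤ 2 ^ j := one_le_pow₀ one_le_two
  have ha' : a = 2 * w * 2 ^ j := by rw [ha]; ring
  rw [← ha] at hb hdec
  have ha0 : 0 < a := by rw [ha]; positivity
  have hb0 : 0 < b := ha0.trans_le hb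
  have hwa : w ≤ a := by rw [ha']; nlinarith
  have h1 : m ≤ K * a ^ n * (a / b) ^ κ :=
    hm ▸ (real_closedBall_mono (closedBall_subset_closedBall hwa)).trans (hdec a le_rfl hb)
  have h2 : (b / a) ^ κ ≤ Y * (2 ^ j) ^ n := by
    have hinv : (a / b) ^ κ * (b / a) ^ κ = 1 := by
      rw [← Real.mul_rpow (by positivity) (by positivity), div_mul_div_cancel₀ hb0.ne',
        div_self ha0.ne', Real.one_rpow]
    have h3 : m * (b / a) ^ κ ≤ K * a ^ n := by
      calc _ ≤ K * a ^ n * (a / b) ^ κ * (b / a) ^ κ := by gcongr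
        _ = _ := by rw [mul_assoc, hinv, mul_one]
    rw [mul_comm, ← le_div_iff₀ hm0] at h3
    refine h3.trans ?_
    rw [hY, ha', mul_pow, ← mul_assoc, mul_div_right_comm]
    gcongr
    linarith
  have hone : (1 : ℝ) ≤ (2 ^ j) ^ n := one_le_pow₀ h2j
  have h4 : b / a ≤ (Y * (2 ^ j) ^ n) ^ q := by
    calc b / a = ((b / a) ^ κ) ^ (1 / κ) := by
          rw [← Real.rpow_mul (by positivity), mul_one_div_cancel hκ.ne', Real.rpow_one]
      _ ≤ (Y * (2 ^ j) ^ n) ^ (1 / κ) := by gcongr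
      _ ≤ (Y * (2 ^ j) ^ n) ^ (q : ℝ) := by
        gcongr
        nlinarith
      _ = _ := Real.rpow_natCast _ _
  have h5 : b ≤ 2 * w * Y ^ q * (2 ^ j) ^ (1 + n * q) := by
    rw [div_le_iff₀ ha0] at h4
    refine h4.trans_eq ?_
    rw [ha', mul_pow, pow_add, pow_mul, pow_one]
    ring
  calc μ.real (closedBall x b) ≤ C * b ^ n := hgr x hx b hb0
    _ ≤ C * (2 * w * Y ^ q * (2 ^ j) ^ (1 + n * q)) ^ n := by gcongr
    _ = _ := by
      rw [mul_pow, ← pow_mul, ← pow_mul, ← pow_mul, ← mul_assoc]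
      congr 2
      ring

theorem BallRBMO.abs_ballAvg_sub_le (hf : BallRBMO μ n η ρ β f) {x : E} (hx : BallsPos μ x)
    {r b : ℝ} (hr : 0 < r) (hrb : r ≤ b) (hb : BallDoubling μ ρ β x b) :
    |ballAvg μ f x r - ballAvg μ f x b| ≤
      μ.real (closedBall x (η * b)) / μ.real (closedBall x r) := by
  rw [le_div_iff₀' (hx.real_pos hr)]
  refine (_root_.abs_ballAvg_sub_le hf.locallyIntegrable hx hr _).trans ?_
  refine le_trans ?_ (hf.oscillation_of_doubling hx (hr.trans_le hrb) hb)
  exact setIntegral_mono_set (integrableOn_closedBall_sub_const hf.locallyIntegrable x b _).abs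
    (Eventually.of_forall fun _ => abs_nonneg _) (closedBall_subset_closedBall hrb).eventuallyLE

theorem BallComparable.abs_sub_le_mul {D : ℝ} (hcmp : BallComparable μ n ρ β K κ D f) {x : E}
    (hx : BallsPos μ x) {w : ℝ} (hw : 0 < w) {b : ℕ → ℝ} (hb : ∀ j, 2 ^ (j + 1) * w ≤ b j)
    (hdec : ∀ j, BallDecay μ n K κ x (2 ^ (j + 1) * w) (b j))
    (hd : ∀ j, BallDoubling μ ρ β x (b j)) (j : ℕ) :
    |ballAvg μ f x (b j) - ballAvg μ f x (b 0)| ≤ D * j := by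
  induction j with
  | zero => simp
  | succ j ih =>
    have hpos : ∀ i : ℕ, 0 < 2 ^ (i + 1) * w := fun i => by positivity
    have hstep : |ballAvg μ f x (b (j + 1)) - ballAvg μ f x (b j)| ≤ D := by
      have h1 := hb j
      have h2 := hb (j + 1)
      have h3 : 2 ^ (j + 1 + 1) * w = 2 * (2 ^ (j + 1) * w) := by ring
      have h4 := hpos j
      rcases le_total (b j) (b (j + 1)) with h | h
      · rw [abs_sub_comm]
        exact hcmp.concentric hx (hpos (j + 1)) (hdec (j + 1)) (by linarith) h (hd _) (hd _)
      · exact hcmp.concentric hx (hpos j) (hdec j) (by linarith) h (hd _) (hd _)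
    have := abs_sub_le (ballAvg μ f x (b (j + 1))) (ballAvg μ f x (b j)) (ballAvg μ f x (b 0))
    push_cast
    linarith

theorem exists_norm_le_two_pow_mul {w : ℝ} (hw : 1 ≤ w) (x : E) :
    ∃ j : ℕ, ‖x‖ ≤ 2 ^ j * w ∧ 2 ^ j ≤ 2 * (1 + ‖x‖) := by
  have hx := norm_nonneg x
  obtain ⟨j, h1, h2⟩ := exists_nat_pow_near (x := 1 + ‖x‖) (by linarith) (one_lt_two (α := ℝ))
  refine ⟨j + 1, ?_, ?_⟩
  · have : (0 : ℝ) < 2 ^ (j + 1) := by positivity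
    nlinarith
  · rw [pow_succ]
    linarith

/-- Global exponential integrability of functions in `RBMO` with respect to a polynomial weight. -/
theorem exists_lintegral_exp_mul_le (hC : 0 < C) (hη : 1 < η) (hρ : 1 < ρ) (hβ : ρ ^ n < β)
    (hgr : BallGrowth μ n C) (h0 : BallsPos μ 0) {r : ℝ} (hr : 0 < r) :
    ∃ (c : ℝ) (M : ℕ) (A : ℝ), 0 < c ∧ 0 < A ∧ ∀ f, BallRBMO μ n η ρ β f →
      |ballAvg μ f 0 r| ≤ 1 →
      ∫⁻ x, ENNReal.ofReal (Real.exp (c * |f x|) * ((1 + ‖x‖) ^ M)⁻¹) ∂μ ≤ ENNReal.ofReal A := by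
  obtain ⟨B, K, κ, hB, hK, hκ, hgood⟩ := exists_ballGood (η := η) hC hρ hβ hgr
  obtain ⟨D, hD, hcmp⟩ := exists_compare_of_decay (η := η) (ρ := ρ) (β := β) hC hK hκ hgr
  obtain ⟨D', hD', hclose⟩ := exists_ae_doubling_close hC hρ hβ hgr η
  obtain ⟨c, hc, hexp⟩ := exists_lintegral_exp_le hgood hη hB hD.le hD'.le
  have hw1 : 1 ≤ r + 1 := by linarith
  obtain ⟨w, hw⟩ : ∃ w, w = r + 1 := ⟨_, rfl⟩
  rw [← hw] at hw1
  have hw0 : 0 < w := by linarith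
  obtain ⟨P, p, hP, hpoly⟩ := exists_measure_le_of_decay hC hK hκ hgr h0 hw0
  choose b hb hbg hbd using fun j : ℕ => hgood 0 h0 (2 ^ (j + 1) * w) (by positivity)
  have hb0 : ∀ j, 0 < b j := fun j => lt_of_lt_of_le (by positivity) (hb j)
  obtain ⟨A₀, hA₀⟩ : ∃ A₀, A₀ = 1 + μ.real (closedBall 0 (η * b 0)) / μ.real (closedBall 0 r) :=
    ⟨_, rfl⟩
  obtain ⟨m, hm⟩ := pow_unbounded_of_one_lt (Real.exp (c * D)) (one_lt_two (α := ℝ))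
  obtain ⟨Q, hQ⟩ : ∃ Q, Q = 2 ^ (m + p + 1) * Real.exp (c * A₀) * (4 * P) := ⟨_, rfl⟩
  have hQ0 : 0 < Q := by rw [hQ]; positivity
  refine ⟨c, m + p + 1, Q * 2, hc, by positivity, fun f hf hfr => ?_⟩
  have havg : ∀ j, |ballAvg μ f 0 (b j)| ≤ A₀ + D * j := by
    intro j
    have hrb : r ≤ b 0 := by
      have := hb 0
      norm_num at this
      linarith
    have h1 := hf.abs_ballAvg_sub_le h0 hr hrb (hbg 0).1
    have h2 := BallComparable.abs_sub_le_mul (hcmp f hf) h0 hw0 hb hbd (fun j => (hbg j).1) j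
    rw [abs_le] at *
    constructor <;> linarith [h1.1, h1.2, h2.1, h2.2]
  let W : ℕ → ℝ := fun j => 2 ^ (m + p + 1) * ((2 ^ j) ^ (m + p + 1))⁻¹ *
    (Real.exp (c * A₀) * Real.exp (c * D) ^ j)
  have hW0 : ∀ j, 0 ≤ W j := fun j => by positivity
  let F : ℕ → E → ℝ≥0∞ := fun j x => ENNReal.ofReal (W j) *
    ENNReal.ofReal (Real.exp (c * |f x - ballAvg μ f 0 (b j)|))
  have hFm : ∀ j, AEMeasurable (F j) μ := fun j => by
    have := hf.locallyIntegrable.aestronglyMeasurable.aemeasurable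
    fun_prop
  have hpt : ∀ x, ENNReal.ofReal (Real.exp (c * |f x|) * ((1 + ‖x‖) ^ (m + p + 1))⁻¹) ≤
      ∑' j, (closedBall 0 (b j / 2)).indicator (F j) x := by
    intro x
    obtain ⟨j, hj1, hj2⟩ := exists_norm_le_two_pow_mul hw1 x
    have hxj : x ∈ closedBall (0 : E) (b j / 2) := by
      rw [mem_closedBall_zero_iff]
      have := hb j
      rw [pow_succ] at this
      linarith
    refine le_trans ?_ (ENNReal.le_tsum j)
    rw [indicator_of_mem hxj]
    simp only [F]
    rw [← ENNReal.ofReal_mul (hW0 j)]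
    refine ENNReal.ofReal_le_ofReal ?_
    have h1 : Real.exp (c * |f x|) ≤ Real.exp (c * A₀) * Real.exp (c * D) ^ j *
        Real.exp (c * |f x - ballAvg μ f 0 (b j)|) := by
      rw [← Real.exp_nat_mul, ← Real.exp_add, ← Real.exp_add]
      refine Real.exp_le_exp.2 ?_
      have h2 := havg j
      have h3 := abs_sub_abs_le_abs_sub (f x) (ballAvg μ f 0 (b j))
      have h4 : c * |f x| ≤ c * (A₀ + D * j + |f x - ballAvg μ f 0 (b j)|) := by
        gcongr
        linarith
      linarith
    have hx0 := norm_nonneg x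
    have h2 : ((1 + ‖x‖) ^ (m + p + 1))⁻¹ ≤
        2 ^ (m + p + 1) * ((2 ^ j) ^ (m + p + 1))⁻¹ := by
      rw [← div_eq_mul_inv, ← div_pow, ← inv_pow]
      gcongr
      rw [inv_le_comm₀ (by positivity) (by positivity), inv_div, div_le_iff₀ two_pos]
      linarith
    calc _ ≤ _ := mul_le_mul h1 h2 (by positivity) (by positivity)
      _ = _ := by simp only [W]; ring
  have hint : ∀ j, ∫⁻ x, (closedBall 0 (b j / 2)).indicator (F j) x ∂μ ≤
      ENNReal.ofReal (Q * (1 / 2) ^ j) := by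
    intro j
    rw [lintegral_indicator measurableSet_closedBall]
    simp only [F]
    rw [lintegral_const_mul' _ _ ENNReal.ofReal_ne_top]
    calc _ ≤ ENNReal.ofReal (W j) * (4 * μ (closedBall 0 (b j))) := by
          gcongr
          exact hexp f hf (hcmp f hf) (hclose f hf) 0 (b j) h0 (hb0 j) (hbg j)
      _ = ENNReal.ofReal (W j * (4 * μ.real (closedBall 0 (b j)))) := by
          rw [ENNReal.ofReal_mul (hW0 j), ENNReal.ofReal_mul (p := 4) (by norm_num),
            ofReal_measureReal measure_closedBall_lt_top.ne, ENNReal.ofReal_ofNat]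
      _ ≤ _ := by
          refine ENNReal.ofReal_le_ofReal ?_
          calc W j * (4 * μ.real (closedBall 0 (b j))) ≤ 2 ^ (m + p + 1) *
                ((2 ^ j) ^ (m + p + 1))⁻¹ * (Real.exp (c * A₀) * (2 ^ m) ^ j) *
                (4 * (P * (2 ^ j) ^ p)) := by
                simp only [W]
                have := hpoly j (b j) (hb j) (hbd j)
                gcongr
            _ = _ := by
                rw [hQ, pow_right_comm 2 m j]
                generalize (2 : ℝ) ^ (m + p + 1) = q
                rw [pow_add _ (m + p), pow_add _ m, pow_one, one_div, inv_pow]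
                have : (2 : ℝ) ^ j ≠ 0 := by positivity
                field_simp
  calc _ ≤ ∫⁻ x, ∑' j, (closedBall 0 (b j / 2)).indicator (F j) x ∂μ := lintegral_mono hpt
    _ = ∑' j, ∫⁻ x, (closedBall 0 (b j / 2)).indicator (F j) x ∂μ :=
      lintegral_tsum fun j => (hFm j).indicator measurableSet_closedBall
    _ ≤ ∑' j, ENNReal.ofReal (Q * (1 / 2) ^ j) := ENNReal.tsum_le_tsum hint
    _ = _ := by
      rw [← ENNReal.ofReal_tsum_of_nonneg (fun j => by positivity)
        (summable_geometric_two.mul_left Q), tsum_mul_left, tsum_geometric_two]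

end Balls

/-- The identification of Euclidean space with `Fin d → ℝ`, equipped with the sup norm. -/
def coordHomeo (d : ℕ) : Euc d ≃ₜ (Fin d → ℝ) := PiLp.homeomorph 2 fun _ => ℝ

/-- The measure `μ` seen on `Fin d → ℝ`, where cubes are balls. -/
def supMeasure {d : ℕ} (μ : Measure (Euc d)) : Measure (Fin d → ℝ) := μ.map (coordHomeo d)

section Transport

variable {d n : ℕ} {μ : Measure (Euc d)} {C₀ η ρ β : ℝ}

/-- The cube with given center, seen in `Fin d → ℝ`, and given half side. -/
def cubeOfBall {d : ℕ} (x : Fin d → ℝ) (r : ℝ) : Cube d := ⟨(coordHomeo d).symm x, 2 * r⟩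

theorem dilate_cubeOfBall (x : Fin d → ℝ) (r α : ℝ) :
    (cubeOfBall x r).dilate α = cubeOfBall x (α * r) := by
  simp only [Cube.dilate, cubeOfBall, Cube.mk.injEq, true_and]
  ring

theorem set_cubeOfBall (x : Fin d → ℝ) {r : ℝ} (hr : 0 ≤ r) :
    (cubeOfBall x r).set = coordHomeo d ⁻¹' closedBall x r := by
  ext y
  rw [mem_preimage, mem_closedBall, dist_pi_le_iff hr]
  simp only [Cube.set, cubeOfBall, mem_ofPred_eq, mul_div_cancel_left₀ r two_ne_zero, Real.dist_eq]
  rfl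

theorem supMeasure_apply (s : Set (Fin d → ℝ)) :
    supMeasure μ s = μ (coordHomeo d ⁻¹' s) :=
  (coordHomeo d).toMeasurableEquiv.map_apply s

theorem measure_cubeOfBall (x : Fin d → ℝ) {r : ℝ} (hr : 0 ≤ r) :
    μ (cubeOfBall x r).set = supMeasure μ (closedBall x r) := by
  rw [set_cubeOfBall x hr, supMeasure_apply]

theorem cubeAvg_cubeOfBall (f : Euc d → ℝ) (x : Fin d → ℝ) {r : ℝ} (hr : 0 ≤ r) :
    cubeAvg μ (cubeOfBall x r) f = ballAvg (supMeasure μ) (f ∘ (coordHomeo d).symm) x r := by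
  rw [cubeAvg, ballAvg, measure_cubeOfBall x hr, set_cubeOfBall x hr]
  congr 1
  refine Eq.symm ((setIntegral_map_equiv (coordHomeo d).toMeasurableEquiv _ _).trans ?_)
  simp [Homeomorph.toMeasurableEquiv]

theorem ballsPos_supMeasure_iff (x : Fin d → ℝ) :
    BallsPos (supMeasure μ) x ↔ ∀ r : ℝ, 0 < r → 0 < μ (ball ((coordHomeo d).symm x) r) := by
  constructor
  · intro h r hr
    have hm : (coordHomeo d).symm ⁻¹' ball ((coordHomeo d).symm x) r ∈ 𝓝 x :=
      (coordHomeo d).symm.continuous.continuousAt.preimage_mem_nhds (ball_mem_nhds _ hr)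
    obtain ⟨s, hs, hsub⟩ := nhds_basis_closedBall.mem_iff.1 hm
    refine (h s hs).trans_le ?_
    rw [supMeasure_apply]
    refine measure_mono fun y hy => ?_
    simpa using hsub hy
  · intro h r hr
    have hm : coordHomeo d ⁻¹' closedBall x r ∈ 𝓝 ((coordHomeo d).symm x) :=
      (coordHomeo d).continuous.continuousAt.preimage_mem_nhds
        (by simpa using closedBall_mem_nhds x hr)
    obtain ⟨s, hs, hsub⟩ := Metric.mem_nhds_iff.1 hm
    rw [supMeasure_apply]
    exact (h s hs).trans_le (measure_mono hsub)

theorem isCube_cubeOfBall {x : Fin d → ℝ} (hx : BallsPos (supMeasure μ) x) {r : ℝ} (hr : 0 < r) :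
    IsCube μ (cubeOfBall x r) :=
  ⟨mul_pos two_pos hr, (ballsPos_supMeasure_iff x).1 hx⟩

theorem isLocallyFiniteMeasure_supMeasure [IsLocallyFiniteMeasure μ] :
    IsLocallyFiniteMeasure (supMeasure μ) := by
  refine ⟨fun x => ?_⟩
  obtain ⟨s, hs, hμ⟩ := μ.finiteAt_nhds ((coordHomeo d).symm x)
  refine ⟨(coordHomeo d).symm ⁻¹' s,
    (coordHomeo d).symm.continuous.continuousAt.preimage_mem_nhds hs, ?_⟩
  rwa [supMeasure_apply, ← preimage_comp, Homeomorph.symm_comp_self, preimage_id]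

theorem isDoubling_cubeOfBall_iff [IsLocallyFiniteMeasure (supMeasure μ)] (hρ : 0 ≤ ρ) (hβ : 0 ≤ β)
    (x : Fin d → ℝ) {r : ℝ} (hr : 0 ≤ r) :
    IsDoubling μ ρ β (cubeOfBall x r) ↔ BallDoubling (supMeasure μ) ρ β x r := by
  rw [IsDoubling, BallDoubling, dilate_cubeOfBall, measure_cubeOfBall x hr,
    measure_cubeOfBall x (mul_nonneg hρ hr), ← ofReal_measureReal measure_closedBall_lt_top.ne,
    ← ofReal_measureReal measure_closedBall_lt_top.ne, ← ENNReal.ofReal_mul hβ,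
    ENNReal.ofReal_le_ofReal_iff (mul_nonneg hβ measureReal_nonneg)]

theorem ballGrowth_supMeasure (hC : 0 ≤ C₀)
    (h : ∀ Q : Cube d, IsCube μ Q → μ Q.set ≤ ENNReal.ofReal (C₀ * Q.side ^ n)) :
    BallGrowth (supMeasure μ) n (C₀ * 2 ^ n) := by
  intro x hx r hr
  have h1 := h _ (isCube_cubeOfBall hx hr)
  rw [measure_cubeOfBall x hr.le] at h1
  refine (ENNReal.toReal_le_of_le_ofReal ?_ h1).trans_eq ?_
  · have : 0 ≤ (cubeOfBall x r).side := (mul_pos two_pos hr).le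
    positivity
  · simp only [cubeOfBall]
    ring

theorem RBMOBound.ballRBMO [IsLocallyFiniteMeasure (supMeasure μ)] {f : Euc d → ℝ}
    (hf : LocallyIntegrable f μ) (h : RBMOBound μ n η ρ β f 1) (hη : 0 ≤ η) (hρ : 0 ≤ ρ)
    (hβ : 0 ≤ β) : BallRBMO (supMeasure μ) n η ρ β (f ∘ (coordHomeo d).symm) where
  locallyIntegrable := by
    refine (locallyIntegrable_map_homeomorph (coordHomeo d)).2 ?_
    rwa [Function.comp_assoc, Homeomorph.symm_comp_self, Function.comp_id]
  oscillation := by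
    intro x hx r hr N hN hmin
    have h1 := h.1 _ (isCube_cubeOfBall hx hr)
    have hdil : ∀ i : ℕ, IsDoubling μ ρ β ((cubeOfBall x r).dilate (2 ^ i)) ↔
        BallDoubling (supMeasure μ) ρ β x (2 ^ i * r) := fun i => by
      rw [dilate_cubeOfBall, isDoubling_cubeOfBall_iff hρ hβ x (by positivity)]
    have hinf : sInf {i : ℕ | IsDoubling μ ρ β ((cubeOfBall x r).dilate (2 ^ i))} = N := by
      have hmem : N ∈ {i : ℕ | IsDoubling μ ρ β ((cubeOfBall x r).dilate (2 ^ i))} := (hdil N).2 hN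
      refine le_antisymm (Nat.sInf_le hmem) ?_
      by_contra hlt
      have hm := Nat.sInf_mem ⟨N, hmem⟩
      exact hmin _ (not_le.1 hlt) ((hdil _).1 hm)
    rw [tilde, hinf, dilate_cubeOfBall, dilate_cubeOfBall, measure_cubeOfBall x (by positivity),
      one_mul, set_cubeOfBall x hr.le, cubeAvg_cubeOfBall f x (by positivity)] at h1
    refine le_trans (le_of_eq ?_) h1
    refine (setIntegral_map_equiv (coordHomeo d).toMeasurableEquiv _ _).trans ?_
    simp [Homeomorph.toMeasurableEquiv]
  compare := by
    intro x z hx hz r b hr hb hsub hzr hxb N hN hbN hmin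
    have h1 := h.2 (cubeOfBall z r) (cubeOfBall x b) (isCube_cubeOfBall hz hr)
      (isCube_cubeOfBall hx hb) (by
        rw [set_cubeOfBall z hr.le, set_cubeOfBall x hb.le]
        exact preimage_mono hsub)
      ((isDoubling_cubeOfBall_iff hρ hβ z hr.le).2 hzr)
      ((isDoubling_cubeOfBall_iff hρ hβ x hb.le).2 hxb)
    have hside : ∀ k : ℕ, (cubeOfBall x b).side ≤ 2 ^ k * (cubeOfBall z r).side ↔
        b ≤ 2 ^ k * r := fun k => by
      simp only [cubeOfBall]
      rw [mul_left_comm, mul_le_mul_iff_right₀ two_pos]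
    have hNQR : NQR (cubeOfBall z r) (cubeOfBall x b) = N := by
      have hmem : N ∈ {k : ℕ | 0 < k ∧ (cubeOfBall x b).side ≤ 2 ^ k * (cubeOfBall z r).side} :=
        ⟨hN, (hside N).2 hbN⟩
      refine le_antisymm (Nat.sInf_le hmem) ?_
      by_contra hlt
      have hm := Nat.sInf_mem ⟨N, hmem⟩
      exact (hmin _ hm.1 (not_le.1 hlt)).not_ge ((hside _).1 hm.2)
    rw [one_mul, SQR, hNQR, cubeAvg_cubeOfBall f z hr.le, cubeAvg_cubeOfBall f x hb.le] at h1
    refine h1.trans_eq ?_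
    congr 1
    refine Finset.sum_congr rfl fun k _ => ?_
    rw [dilate_cubeOfBall, measure_cubeOfBall z (by positivity)]
    rfl

end Transport

theorem one_le_log_exp_one_add {t : ℝ} (ht : 0 ≤ t) : 1 ≤ Real.log (Real.exp 1 + t) := by
  rw [Real.le_log_iff_exp_le (by positivity)]
  linarith

theorem wp_le_self {t : ℝ} (ht : 0 ≤ t) : wp t ≤ t :=
  div_le_self ht (one_le_log_exp_one_add ht)

/-- A Young-type inequality for `℘`, with exponential weight on one side. -/
theorem wp_mul_div_log_le {c A k h g N : ℝ} {M : ℕ} (hc : 0 < c) (hA : 0 < A) (hk : 0 < k)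
    (hk1 : 16 * (M + 1) / c ≤ k) (hk2 : 4 * A / c ≤ k) (hh : 0 ≤ h) (hg : 0 ≤ g) (hN : 0 ≤ N) :
    wp (h * g / k) * (Real.log (Real.exp 1 + N))⁻¹ ≤
      g / 2 + (2 * A)⁻¹ * (Real.exp (c * h) * ((1 + N) ^ M)⁻¹) := by
  have hlN := one_le_log_exp_one_add hN
  have hlg := one_le_log_exp_one_add hg
  have he : 1 < Real.exp 1 := Real.one_lt_exp_iff.2 one_pos
  have ht : 0 ≤ h * g / k := by positivity
  have hlt := one_le_log_exp_one_add ht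
  obtain ⟨l, hl⟩ : ∃ l, l = Real.log (Real.exp 1 + N) := ⟨_, rfl⟩
  obtain ⟨m, hm⟩ : ∃ m, m = Real.log (Real.exp 1 + g) := ⟨_, rfl⟩
  rw [← hl] at hlN ⊢
  rw [← hm] at hlg
  have hle : wp (h * g / k) * l⁻¹ ≤ h * g / k :=
    (mul_le_of_le_one_right (div_nonneg ht (by linarith)) (inv_le_one_of_one_le₀ hlN)).trans
      (wp_le_self ht)
  have hrest : 0 ≤ (2 * A)⁻¹ * (Real.exp (c * h) * ((1 + N) ^ M)⁻¹) := by positivity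
  rcases le_or_gt h (k / 2) with hhk | hhk
  · have : h * g / k ≤ g / 2 := by
      rw [div_le_div_iff₀ hk two_pos]
      nlinarith
    linarith
  have hmt : m ≤ 2 * Real.log (Real.exp 1 + h * g / k) := by
    have htg : g / 2 ≤ h * g / k := by
      rw [div_le_div_iff₀ two_pos hk]
      nlinarith
    rw [hm, ← Real.log_rpow (by positivity), Real.rpow_two]
    refine Real.log_le_log (by positivity) ?_
    nlinarith [mul_nonneg ht (sub_nonneg.2 he.le), sq_nonneg (h * g / k)]
  rcases le_or_gt h (4 * (M + 1) / c * (m * l)) with hhm | hhm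
  · have h1 : wp (h * g / k) * l⁻¹ ≤ g / 2 := by
      rw [wp, div_mul_eq_mul_div, ← div_eq_mul_inv, div_div, div_div,
        div_le_div_iff₀ (by positivity) two_pos]
      have h2 : 2 * h ≤ k * (l * Real.log (Real.exp 1 + h * g / k)) := by
        have h3 : 2 * (4 * (M + 1) / c * (m * l)) ≤ k / 2 * (m * l) := by
          have : 0 ≤ m * l := by positivity
          have h4 : 16 * ((M : ℝ) + 1) / c = 4 * (4 * (M + 1) / c) := by ring
          rw [h4] at hk1
          nlinarith
        have h4 : k / 2 * (m * l) ≤ k / 2 * (2 * Real.log (Real.exp 1 + h * g / k) * l) := by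
          gcongr
        linarith
      calc h * g * 2 = g * (2 * h) := by ring
        _ ≤ g * (k * (l * Real.log (Real.exp 1 + h * g / k))) := by gcongr
        _ = _ := by ring
    linarith
  · have h1 : (Real.exp 1 + g) * (Real.exp 1 + N) ≤ Real.exp (c * h / (2 * (M + 1))) := by
      rw [← Real.exp_log (show 0 < Real.exp 1 + g by positivity),
        ← Real.exp_log (show 0 < Real.exp 1 + N by positivity), ← hl, ← hm, ← Real.exp_add]
      refine Real.exp_le_exp.2 ?_
      rw [le_div_iff₀ (by positivity)]
      rw [div_mul_eq_mul_div, div_lt_iff₀ hc] at hhm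
      have : m + l ≤ 2 * (m * l) := by nlinarith
      have h5 : 0 ≤ 2 * ((M : ℝ) + 1) := by positivity
      nlinarith
    have h2 : g * (1 + N) ^ M ≤ Real.exp (c * h / 2) := by
      calc g * (1 + N) ^ M ≤ (Real.exp 1 + g) ^ (M + 1) * (Real.exp 1 + N) ^ (M + 1) := by
            have h3 : 1 ≤ (Real.exp 1 + g) ^ M := one_le_pow₀ (by linarith)
            have h4 : g ≤ (Real.exp 1 + g) ^ (M + 1) := by
              rw [pow_succ]
              nlinarith
            have h5 : (1 + N) ^ M ≤ (Real.exp 1 + N) ^ (M + 1) :=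
              (pow_le_pow_left₀ (by positivity) (by linarith) M).trans
                (pow_le_pow_right₀ (by linarith) M.le_succ)
            gcongr
        _ ≤ Real.exp (c * h / (2 * (M + 1))) ^ (M + 1) := by
            rw [← mul_pow]
            gcongr
        _ = Real.exp (c * h / 2) := by
            rw [← Real.exp_nat_mul]
            congr 1
            push_cast
            field_simp
    have h3 : h ≤ 2 / c * Real.exp (c * h / 2) := by
      rw [div_mul_eq_mul_div, le_div_iff₀ hc]
      linarith [Real.add_one_le_exp (c * h / 2)]
    have h4 : 2 / c / k ≤ (2 * A)⁻¹ := by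
      rw [div_div, ← one_div, div_le_div_iff₀ (by positivity) (by positivity)]
      rw [div_le_iff₀ hc] at hk2
      linarith
    have hNM : 0 < (1 + N) ^ M := by positivity
    have h5 : h * g / k ≤ (2 * A)⁻¹ * (Real.exp (c * h) * ((1 + N) ^ M)⁻¹) := by
      calc h * g / k = h * (g * (1 + N) ^ M) * ((1 + N) ^ M)⁻¹ / k := by field_simp
        _ ≤ 2 / c * Real.exp (c * h / 2) * Real.exp (c * h / 2) * ((1 + N) ^ M)⁻¹ / k := by
          gcongr
        _ = 2 / c / k * (Real.exp (c * h) * ((1 + N) ^ M)⁻¹) := by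
          rw [show c * h = c * h / 2 + c * h / 2 by ring, Real.exp_add]
          ring_nf
        _ ≤ _ := by gcongr
    linarith

section Scaling

variable {d n : ℕ} {μ : Measure (Euc d)} {C₀ η ρ β : ℝ}

theorem cubeAvg_const_mul (Q : Cube d) (f : Euc d → ℝ) (a : ℝ) :
    cubeAvg μ Q (fun x => a * f x) = a * cubeAvg μ Q f := by
  rw [cubeAvg, cubeAvg, integral_const_mul]
  ring

theorem RBMOBound.inv_mul {f : Euc d → ℝ} {C D : ℝ} (h : RBMOBound μ n η ρ β f C) (hCD : C ≤ D)
    (hD : 0 < D) : RBMOBound μ n η ρ β (fun x => D⁻¹ * f x) 1 := by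
  refine ⟨fun Q hQ => ?_, fun Q R hQ hR hQR hdQ hdR => ?_⟩
  · simp only [cubeAvg_const_mul, ← mul_sub, abs_mul, abs_inv, abs_of_pos hD]
    rw [integral_const_mul, one_mul, inv_mul_le_iff₀ hD]
    exact (h.1 Q hQ).trans (by gcongr)
  · rw [cubeAvg_const_mul, cubeAvg_const_mul, ← mul_sub, abs_mul, abs_inv, abs_of_pos hD, one_mul,
      inv_mul_le_iff₀ hD]
    refine (h.2 Q R hQ hR hQR hdQ hdR).trans ?_
    have hS : 0 ≤ SQR μ n Q R := by
      have := hQ.1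
      rw [SQR]
      positivity
    gcongr

theorem MemRBMO.rbmoBound_of_lt {f : Euc d → ℝ} (hf : MemRBMO μ n η ρ β f) {D : ℝ}
    (hD : rbmoNorm μ n η ρ β f < D) : ∃ C, 0 ≤ C ∧ C ≤ D ∧ RBMOBound μ n η ρ β f C := by
  obtain ⟨C, hC, hCD⟩ := exists_lt_of_csInf_lt hf.2 hD
  exact ⟨C, hC.1, hCD.le, hC.2⟩

theorem norm_coordHomeo_le (x : Euc d) : ‖coordHomeo d x‖ ≤ ‖x‖ :=
  (pi_norm_le_iff_of_nonneg (norm_nonneg x)).2 fun i => PiLp.norm_apply_le x i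

theorem exists_lintegral_exp_mul_le_of_rbmoBound [IsLocallyFiniteMeasure μ] (hC₀ : 0 < C₀)
    (hgrowthQ : ∀ Q : Cube d, IsCube μ Q → μ Q.set ≤ ENNReal.ofReal (C₀ * Q.side ^ n))
    (hη : 1 < η) (hρ : 1 < ρ) (hβ : ρ ^ n < β)
    (h0 : ∀ r : ℝ, 0 < r → 0 < μ (Metric.ball (0 : Euc d) r)) :
    ∃ (c : ℝ) (M : ℕ) (A : ℝ), 0 < c ∧ 0 < A ∧ ∀ f, LocallyIntegrable f μ →
      RBMOBound μ n η ρ β f 1 → |cubeAvg μ (tilde μ ρ β (Cube.mk (0 : Euc d) 1)) f| ≤ 1 →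
      ∫⁻ x, ENNReal.ofReal (Real.exp (c * |f x|) * ((1 + ‖x‖) ^ M)⁻¹) ∂μ ≤ ENNReal.ofReal A := by
  have := isLocallyFiniteMeasure_supMeasure (μ := μ)
  have hβ0 : 0 ≤ β := (pow_pos (one_pos.trans hρ) n).le.trans hβ.le
  obtain ⟨N, hN⟩ : ∃ N : ℕ, tilde μ ρ β (Cube.mk (0 : Euc d) 1) =
      cubeOfBall 0 (2 ^ N * (1 / 2)) := by
    have h1 : Cube.mk (0 : Euc d) 1 = cubeOfBall 0 (1 / 2) := by
      simp only [cubeOfBall, Cube.mk.injEq]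
      exact ⟨rfl, by norm_num⟩
    rw [tilde, h1]
    exact ⟨_, dilate_cubeOfBall _ _ _⟩
  have hr : (0 : ℝ) < 2 ^ N * (1 / 2) := by positivity
  obtain ⟨c, M, A, hc, hA, h⟩ := exists_lintegral_exp_mul_le (by positivity) hη hρ hβ
    (ballGrowth_supMeasure hC₀.le hgrowthQ) ((ballsPos_supMeasure_iff (0 : Fin d → ℝ)).2 h0) hr
  refine ⟨c, M, A, hc, hA, fun f hf hfb hfa => ?_⟩
  rw [hN, cubeAvg_cubeOfBall f _ hr.le] at hfa
  refine le_trans (le_trans ?_ (lintegral_map_equiv _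
    (coordHomeo d).toMeasurableEquiv).ge) (h _ (hfb.ballRBMO hf (by linarith) (by linarith) hβ0) hfa)
  refine lintegral_mono fun x => ENNReal.ofReal_le_ofReal ?_
  simp only [Function.comp_apply, Homeomorph.toMeasurableEquiv_coe, Homeomorph.symm_apply_apply]
  have := norm_coordHomeo_le x
  gcongr

theorem orliczNorm_wp_mul_le {F g : Euc d → ℝ} {c A k G : ℝ} {M : ℕ} (hc : 0 < c) (hA : 0 < A)
    (hk : 0 < k) (hk1 : 16 * (M + 1) / c ≤ k) (hk2 : 4 * A / c ≤ k)
    (hF : ∫⁻ x, ENNReal.ofReal (Real.exp (c * |F x|) * ((1 + ‖x‖) ^ M)⁻¹) ∂μ ≤ ENNReal.ofReal A)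
    (hg : Integrable g μ) (hG : ∫ x, |g x| ∂μ ≤ G) (hG0 : 0 < G) {D : ℝ} (hD : 0 < D) :
    orliczNorm wp (nuMeas μ) (fun x => D * F x * g x) ≤ ENNReal.ofReal (k * D * G) := by
  have hkDG : 0 < k * D * G := by positivity
  refine sInf_le ⟨ENNReal.ofReal_pos.2 hkDG, ENNReal.ofReal_ne_top, ?_⟩
  rw [Measure.restrict_univ, ENNReal.toReal_ofReal hkDG.le]
  have hmeas : Measurable fun x : Euc d => ENNReal.ofReal (Real.log (Real.exp 1 + ‖x‖))⁻¹ := by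
    fun_prop
  refine (lintegral_withDensity_le_lintegral_mul μ hmeas _).trans ?_
  have hpt : ∀ x, ((fun x : Euc d => ENNReal.ofReal (Real.log (Real.exp 1 + ‖x‖))⁻¹) *
      fun x => ENNReal.ofReal (wp (|D * F x * g x| / (k * D * G)))) x ≤
      ENNReal.ofReal ((2 * G)⁻¹ * |g x|) + ENNReal.ofReal (2 * A)⁻¹ *
        ENNReal.ofReal (Real.exp (c * |F x|) * ((1 + ‖x‖) ^ M)⁻¹) := by
    intro x
    have h := wp_mul_div_log_le hc hA hk hk1 hk2 (abs_nonneg (F x))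
      (div_nonneg (abs_nonneg (g x)) hG0.le) (norm_nonneg x)
    have hlog := one_le_log_exp_one_add (norm_nonneg x)
    rw [Pi.mul_apply, ← ENNReal.ofReal_mul (by positivity), ← ENNReal.ofReal_mul (by positivity),
      ← ENNReal.ofReal_add (by positivity) (by positivity)]
    refine ENNReal.ofReal_le_ofReal ?_
    have h1 : |D * F x * g x| / (k * D * G) = |F x| * (|g x| / G) / k := by
      rw [abs_mul, abs_mul, abs_of_pos hD]
      field_simp
    have h2 : (2 * G)⁻¹ * |g x| = |g x| / G / 2 := by field_simp
    rw [h1, h2, mul_comm]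
    exact h
  refine (lintegral_mono hpt).trans ?_
  rw [lintegral_add_left' (hg.abs.const_mul _).aestronglyMeasurable.aemeasurable.ennreal_ofReal,
    lintegral_const_mul' _ _ ENNReal.ofReal_ne_top,
    ← ofReal_integral_eq_lintegral_ofReal (hg.abs.const_mul _)
      (Eventually.of_forall fun x => by positivity), integral_const_mul]
  calc _ ≤ ENNReal.ofReal (1 / 2) + ENNReal.ofReal (2 * A)⁻¹ * ENNReal.ofReal A := by
        gcongr
        rw [inv_mul_le_iff₀ (by positivity)]
        linarith
    _ = 1 := by
      rw [← ENNReal.ofReal_mul (by positivity), ← ENNReal.ofReal_add (by norm_num) (by positivity),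
        ← ENNReal.ofReal_one]
      congr 1
      field_simp
      norm_num

end Scaling

/-- `‖fg‖_{L^℘(ν)} ≤ C (‖f‖_{RBMO(μ)} + |f_{𝕢̃}|) ‖g‖_{L¹(μ)}`, where `𝕢`
is the unit cube centered at the origin and `dν = dμ/log(e+|x|)`. -/
theorem RBMO_mul_L1_orlicz_weighted
    {d n : ℕ} (μ : Measure (Euc d)) (C₀ η ρ β : ℝ)
    (hn : 0 < n) (hnd : n ≤ d) (hC₀ : 0 < C₀)
    (hgrowth : ∀ x : Euc d, ∀ r : ℝ, 0 < r →
      μ (Metric.ball x r) ≤ ENNReal.ofReal (C₀ * r ^ n))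
    (hgrowthQ : ∀ Q : Cube d, IsCube μ Q → μ Q.set ≤ ENNReal.ofReal (C₀ * Q.side ^ n))
    (hη : 1 < η) (hρ : 1 < ρ) (hβ : ρ ^ n < β)
    (h0 : ∀ r : ℝ, 0 < r → 0 < μ (Metric.ball (0 : Euc d) r)) :
    ∃ C : ℝ, 0 < C ∧
      ∀ f : Euc d → ℝ, MemRBMO μ n η ρ β f →
        ∀ g : Euc d → ℝ, Integrable g μ →
          orliczNorm wp (nuMeas μ) (fun x => f x * g x)
            ≤ ENNReal.ofReal
                (C * (rbmoNorm μ n η ρ β f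
                      + |cubeAvg μ (tilde μ ρ β (Cube.mk (0 : Euc d) 1)) f|)
                  * ∫ x, |g x| ∂μ) := by
  have hfin : IsLocallyFiniteMeasure μ := ⟨fun x =>
    ⟨ball x 1, ball_mem_nhds x one_pos, (hgrowth x 1 one_pos).trans_lt ENNReal.ofReal_lt_top⟩⟩
  obtain ⟨c, M, A, hc, hA, hexp⟩ :=
    exists_lintegral_exp_mul_le_of_rbmoBound hC₀ hgrowthQ hη hρ hβ h0
  obtain ⟨k, hk⟩ : ∃ k, k = max (16 * (M + 1) / c) (4 * A / c) := ⟨_, rfl⟩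
  have hk0 : 0 < k := hk ▸ lt_max_of_lt_right (by positivity)
  refine ⟨k, hk0, fun f hf g hg => ?_⟩
  obtain ⟨a, ha⟩ : ∃ a, a = |cubeAvg μ (tilde μ ρ β (Cube.mk (0 : Euc d) 1)) f| := ⟨_, rfl⟩
  have hnorm : 0 ≤ rbmoNorm μ n η ρ β f := Real.sInf_nonneg fun C hC => hC.1
  have hg0 : 0 ≤ ∫ x, |g x| ∂μ := integral_nonneg fun x => abs_nonneg _
  rw [← ha]
  have ha0 : 0 ≤ a := ha ▸ abs_nonneg _
  have hε : ∀ ε : ℝ, 0 < ε → orliczNorm wp (nuMeas μ) (fun x => f x * g x) ≤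
      ENNReal.ofReal (k * (rbmoNorm μ n η ρ β f + ε + a) * (∫ x, |g x| ∂μ + ε)) := by
    intro ε hε
    obtain ⟨D, hD⟩ : ∃ D, D = rbmoNorm μ n η ρ β f + ε + a := ⟨_, rfl⟩
    have hD0 : 0 < D := by linarith
    obtain ⟨C, -, hCD, hfC⟩ := hf.rbmoBound_of_lt (lt_add_of_pos_right _ hε)
    have hF := hexp (fun x => D⁻¹ * f x) (hf.1.smul D⁻¹)
      (hfC.inv_mul (by linarith) hD0) (by
        rw [cubeAvg_const_mul, abs_mul, abs_inv, abs_of_pos hD0, ← ha, inv_mul_le_iff₀ hD0]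
        linarith)
    have h := orliczNorm_wp_mul_le hc hA hk0 (hk ▸ le_max_left _ _) (hk ▸ le_max_right _ _) hF hg
      (le_add_of_nonneg_right hε.le) (by linarith) hD0
    simp only [mul_inv_cancel_left₀ hD0.ne'] at h
    rwa [hD] at h
  have hlim : Tendsto (fun ε : ℝ => ENNReal.ofReal
      (k * (rbmoNorm μ n η ρ β f + ε + a) * (∫ x, |g x| ∂μ + ε))) (𝓝[>] 0)
      (𝓝 (ENNReal.ofReal (k * (rbmoNorm μ n η ρ β f + 0 + a) * (∫ x, |g x| ∂μ + 0)))) := by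
    refine tendsto_nhdsWithin_of_tendsto_nhds (ENNReal.tendsto_ofReal (Continuous.tendsto ?_ 0))
    fun_prop
  rw [add_zero, add_zero] at hlim
  exact ge_of_tendsto hlim (eventually_mem_nhdsWithin.mono hε)
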